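/- Under the auxiliary problem setting, there exists a constant C > 0, depending only on n, Q, the exponent function α, the cut-off ξ, the initial datum u₀, and the constant c (but not on T), such that every solution u of the auxiliary problem on [0,T] satisfies the interior gradient bound |∇u(x,t)| ≤ C·(1 + t) for all (x,t) ∈ closure(Q) × [0,T]. -/

import Mathlib

noncomputable section
open Set

abbrev En (n : ℕ) := EuclideanSpace ℝ (Fin n)

/-- Partial derivative `∂ᵢ f` at `x`. -/
noncomputable def pd {n : ℕ} (f : En n → ℝ) (i : Fin n) (x : En n) : ℝ :=
  fderiv ℝ f x (EuclideanSpace.single i 1)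

/-- `|∇f|²` at `x`. -/
noncomputable def gradNormSq {n : ℕ} (f : En n → ℝ) (x : En n) : ℝ :=
  ∑ i : Fin n, (pd f i x) ^ 2

/-- `v(f) = √(1+|∇f|²)`. -/
noncomputable def graphV {n : ℕ} (f : En n → ℝ) (x : En n) : ℝ :=
  Real.sqrt (1 + gradNormSq f x)

/-- Mean curvature `H[f] = div(∇f / v(f))` of `graph f`. -/
noncomputable def meanCurv {n : ℕ} (f : En n → ℝ) (x : En n) : ℝ :=
  ∑ i : Fin n, pd (fun y => pd f i y / graphV f y) i x

/-- The operator `G[f](x) = v(f)(x) · H[f](x)^{α(x)}` (real power). -/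
noncomputable def Gop {n : ℕ} (alp : En n → ℝ) (f : En n → ℝ) (x : En n) : ℝ :=
  graphV f x * meanCurv f x ^ alp x

/-- The data of the auxiliary problem setting. -/
structure AuxSetting (n : ℕ) where
  /-- the bounded smooth domain -/
  Q : Set (En n)
  /-- defining function for the domain -/
  rho : En n → ℝ
  /-- the variable exponent -/
  alp : En n → ℝ
  /-- the initial datum -/
  u0 : En n → ℝ
  /-- the cut-off function -/
  xi : En n → ℝ
  /-- the constant in the boundary condition -/
  c : ℝ
  hn : 1 ≤ n
  hrho : ContDiff ℝ (⊤ : ℕ∞) rho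
  hQdef : Q = {x | rho x < 0}
  hfront : frontier Q = {x | rho x = 0}
  hgrad : ∀ x ∈ frontier Q, fderiv ℝ rho x ≠ 0
  hbdd : Bornology.IsBounded Q
  halp_smooth : ContDiffOn ℝ (⊤ : ℕ∞) alp (closure Q)
  halp_pos : ∀ x ∈ closure Q, 0 < alp x
  halp_one : ∃ V : Set (En n), IsOpen V ∧ frontier Q ⊆ V ∧ ∀ x ∈ V, alp x = 1
  hu0_smooth : ContDiffOn ℝ (⊤ : ℕ∞) u0 (closure Q)
  hu0_nonpos : ∀ x ∈ closure Q, u0 x ≤ 0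
  hu0_bdry : ∀ x ∈ frontier Q, u0 x = 0
  hu0_H : ∀ x ∈ closure Q, 0 < meanCurv u0 x
  hc : 0 < c
  hGc : ∀ x ∈ closure Q, c ≤ Gop alp u0 x
  hxi_smooth : ContDiffOn ℝ (⊤ : ℕ∞) xi (closure Q)
  hxi_range : ∀ x ∈ closure Q, xi x ∈ Set.Icc (0:ℝ) 1
  hxi_one : ∃ V : Set (En n), IsOpen V ∧ frontier Q ⊆ V ∧ ∀ x ∈ V, xi x = 1
  halp_xi : ∃ W : Set (En n), IsOpen W ∧ closure Q ∩ Function.support xi ⊆ W ∧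
      ∀ x ∈ W, alp x = 1

/-- `u` is a solution of the auxiliary problem on `[0,T]`. -/
def IsAuxSolution {n : ℕ} (S : AuxSetting n) (T : ℝ) (u : En n → ℝ → ℝ) : Prop :=
  ContDiffOn ℝ (⊤ : ℕ∞) (fun p : En n × ℝ => u p.1 p.2) (closure S.Q ×ˢ Set.Icc 0 T) ∧
  (∀ t ∈ Set.Icc (0:ℝ) T, ∀ x ∈ closure S.Q, 0 < meanCurv (fun y => u y t) x) ∧
  (∀ x ∈ S.Q, ∀ t ∈ Set.Ioc (0:ℝ) T,
    deriv (u x) t = Gop S.alp (fun y => u y t) x - S.xi x * (Gop S.alp S.u0 x - S.c)) ∧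
  (∀ x ∈ frontier S.Q, ∀ t ∈ Set.Icc (0:ℝ) T, u x t = S.c * t) ∧
  (∀ x ∈ closure S.Q, u x 0 = S.u0 x)


/-- Directional derivative. -/
def dd {E : Type*} [NormedAddCommGroup E] [NormedSpace ℝ E] (f : E → ℝ) (d : E) (x : E) : ℝ :=
  fderiv ℝ f x d

lemma pd_eq_dd {n : ℕ} (f : En n → ℝ) (i : Fin n) :
    pd f i = dd f (EuclideanSpace.single i 1) := rfl

section general
variable {E : Type*} [NormedAddCommGroup E] [NormedSpace ℝ E]

lemma dd_contDiffAt {f : E → ℝ} {x : E} {m k : WithTop ℕ∞} (hf : ContDiffAt ℝ m f x)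
    (hk : k + 1 ≤ m) (d : E) : ContDiffAt ℝ k (dd f d) x := by
  unfold dd
  exact (hf.fderiv_right hk).clm_apply contDiffAt_const

lemma dd_dd {f : E → ℝ} {x : E} (hf : ContDiffAt ℝ 2 f x) (a b : E) :
    dd (dd f a) b x = fderiv ℝ (fderiv ℝ f) x b a := by
  have h1 : DifferentiableAt ℝ (fderiv ℝ f) x :=
    (hf.fderiv_right (m := 1) (by norm_num)).differentiableAt (by norm_num)
  unfold dd
  rw [fderiv_clm_apply h1 (differentiableAt_const a)]
  simp

lemma dd_symm {f : E → ℝ} {x : E} (hf : ContDiffAt ℝ 2 f x) (a b : E) :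
    dd (dd f a) b x = dd (dd f b) a x := by
  rw [dd_dd hf, dd_dd hf]
  exact (hf.isSymmSndFDerivAt (by simp)) b a

lemma dd_congr {f g : E → ℝ} {x : E} (h : f =ᶠ[nhds x] g) (d : E) : dd f d x = dd g d x := by
  unfold dd; rw [h.fderiv_eq]

lemma dd_congr_ev {f g : E → ℝ} {x : E} (h : f =ᶠ[nhds x] g) (d : E) :
    dd f d =ᶠ[nhds x] dd g d := by
  filter_upwards [h.eventually_nhds] with y hy
  exact dd_congr hy d

/-- derivative along a line -/
lemma hasDerivAt_line {f : E → ℝ} {x d : E} {s : ℝ} (hf : DifferentiableAt ℝ f (x + s • d)) :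
    HasDerivAt (fun r : ℝ => f (x + r • d)) (dd f d (x + s • d)) s := by
  have h1 : HasDerivAt (fun r : ℝ => x + r • d) d s := by
    simpa using ((hasDerivAt_id s).smul_const d).const_add x
  exact hf.hasFDerivAt.comp_hasDerivAt s h1

lemma hasDerivAt_line0 {f : E → ℝ} {x d : E} (hf : DifferentiableAt ℝ f x) :
    HasDerivAt (fun r : ℝ => f (x + r • d)) (dd f d x) 0 := by
  have := hasDerivAt_line (f := f) (x := x) (d := d) (s := 0) (by simpa using hf)
  simpa using this

lemma line_tendsto (x d : E) : Filter.Tendsto (fun r : ℝ => x + r • d) (nhds 0) (nhds x) := by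
  have : Continuous (fun r : ℝ => x + r • d) := by fun_prop
  simpa using this.tendsto 0

lemma dd_dd_nonpos {f : E → ℝ} {x : E} (hf : ContDiffAt ℝ 2 f x) (hm : IsLocalMax f x) (d : E) :
    dd (dd f d) d x ≤ 0 := by
  set φ : ℝ → ℝ := fun r => f (x + r • d) with hφ
  have hev : ∀ᶠ r in nhds (0:ℝ), ContDiffAt ℝ 2 f (x + r • d) :=
    (line_tendsto x d).eventually (hf.eventually (by simp))
  have hd1 : deriv φ =ᶠ[nhds 0] fun r => dd f d (x + r • d) := by
    filter_upwards [hev] with r hr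
    exact (hasDerivAt_line (hr.differentiableAt (by norm_num))).deriv
  have hd2 : deriv (deriv φ) 0 = dd (dd f d) d x := by
    rw [hd1.deriv_eq]
    exact (hasDerivAt_line0 ((dd_contDiffAt (k := 1) hf (by norm_num) d).differentiableAt
      (by norm_num))).deriv
  have hmax : IsLocalMax φ 0 := by
    have := (line_tendsto x d).eventually hm
    filter_upwards [this] with r hr
    simpa [hφ] using hr
  have hd0 : deriv φ 0 = 0 := hmax.deriv_eq_zero
  by_contra hcon
  push Not at hcon
  have hmin : IsLocalMin φ 0 := by
    apply isLocalMin_of_deriv_deriv_pos (by rw [hd2]; exact hcon) hd0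
    exact (hasDerivAt_line0 (hf.differentiableAt (by norm_num))).continuousAt
  have hconst : φ =ᶠ[nhds 0] fun _ => φ 0 := by
    filter_upwards [hmin, hmax] with r h1 h2
    exact le_antisymm h2 h1
  have : deriv (deriv φ) 0 = 0 := by
    rw [(hconst.deriv).deriv_eq]; simp
  linarith

end general

lemma vec_sum {n : ℕ} (d : En n) : d = ∑ i, d i • (EuclideanSpace.single i (1:ℝ) : En n) := by
  ext j
  simp [Finset.sum_apply, Pi.single_apply]

lemma dd_expand {n : ℕ} (f : En n → ℝ) (d x : En n) : dd f d x = ∑ i, d i * pd f i x := by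
  unfold dd pd
  conv_lhs => rw [vec_sum d]
  simp

lemma dd_dd_expand {n : ℕ} {f : En n → ℝ} {x : En n} (hf : ContDiffAt ℝ 2 f x) (a b : En n) :
    dd (dd f a) b x = ∑ i, ∑ j, a i * b j * pd (pd f i) j x := by
  have h : ∀ i j, pd (pd f i) j x = fderiv ℝ (fderiv ℝ f) x (EuclideanSpace.single j 1)
      (EuclideanSpace.single i 1) := fun i j => dd_dd hf _ _
  simp_rw [h]
  rw [dd_dd hf]
  conv_lhs => rw [vec_sum a, vec_sum b]
  simp only [map_sum, map_smul, sum_apply, smul_apply,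
    smul_eq_mul, Finset.mul_sum]
  refine Finset.sum_congr rfl fun i _ => Finset.sum_congr rfl fun j _ => by ring

lemma gradNormSq_eq {n : ℕ} (f : En n → ℝ) (x : En n) : gradNormSq f x = ‖fderiv ℝ f x‖ ^ 2 := by
  set p := fderiv ℝ f x with hp
  obtain ⟨y, hy⟩ := (InnerProductSpace.toDual ℝ (En n)).surjective p
  have h1 : ‖p‖ = ‖y‖ := by rw [← hy]; simp
  rw [h1, EuclideanSpace.norm_sq_eq]
  unfold gradNormSq pd
  rw [← hp, ← hy]
  refine Finset.sum_congr rfl fun i _ => ?_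
  simp [InnerProductSpace.toDual_apply_apply, EuclideanSpace.inner_single_right]

lemma gradNormSq_nonneg {n : ℕ} (f : En n → ℝ) (x : En n) : 0 ≤ gradNormSq f x := by
  unfold gradNormSq; positivity

lemma graphV_pos {n : ℕ} (f : En n → ℝ) (x : En n) : 0 < graphV f x := by
  unfold graphV; have := gradNormSq_nonneg f x; positivity

lemma graphV_sq {n : ℕ} (f : En n → ℝ) (x : En n) : graphV f x ^ 2 = 1 + gradNormSq f x := by
  unfold graphV; have := gradNormSq_nonneg f x; rw [Real.sq_sqrt (by positivity)]

lemma pd_contDiffAt {n : ℕ} {f : En n → ℝ} {x : En n} {m k : WithTop ℕ∞} (hf : ContDiffAt ℝ m f x)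
    (hk : k + 1 ≤ m) (i : Fin n) : ContDiffAt ℝ k (pd f i) x := dd_contDiffAt hf hk _

/-- derivative of `√(1+∑ pᵢ²)`. -/
lemma hasDerivAt_sqrt_sum {n : ℕ} {P : Fin n → ℝ → ℝ} {P' : Fin n → ℝ} {s : ℝ}
    (hP : ∀ i, HasDerivAt (P i) (P' i) s) :
    HasDerivAt (fun r => Real.sqrt (1 + ∑ i, (P i r) ^ 2))
      ((∑ i, P i s * P' i) / Real.sqrt (1 + ∑ i, (P i s) ^ 2)) s := by
  have h1 : HasDerivAt (fun r => 1 + ∑ i, (P i r) ^ 2) (∑ i, 2 * (P i s * P' i)) s := by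
    have : HasDerivAt (fun r => ∑ i, (P i r) ^ 2) (∑ i, 2 * (P i s * P' i)) s := by
      apply HasDerivAt.fun_sum
      intro i _
      have := (hP i).pow 2
      refine this.congr_deriv ?_
      norm_num; ring
    simpa using this.const_add 1
  have hpos : (0:ℝ) < 1 + ∑ i, (P i s) ^ 2 := by positivity
  refine (h1.sqrt hpos.ne').congr_deriv ?_
  rw [← Finset.mul_sum]
  field_simp

lemma graphV_differentiableAt {n : ℕ} {f : En n → ℝ} {x : En n} (hf : ContDiffAt ℝ 2 f x) :
    DifferentiableAt ℝ (graphV f) x := by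
  unfold graphV gradNormSq
  have : ∀ i, DifferentiableAt ℝ (pd f i) x := fun i =>
    (pd_contDiffAt (k := 1) hf (by norm_num) i).differentiableAt (by norm_num)
  apply DifferentiableAt.sqrt
  · fun_prop
  · positivity

lemma graphV_line {n : ℕ} {f : En n → ℝ} {x : En n} (hf : ContDiffAt ℝ 2 f x) (d : En n) :
    HasDerivAt (fun r : ℝ => graphV f (x + r • d))
      ((∑ i, pd f i x * dd (pd f i) d x) / graphV f x) 0 := by
  have h : ∀ i, HasDerivAt (fun r : ℝ => pd f i (x + r • d)) (dd (pd f i) d x) 0 := fun i =>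
    hasDerivAt_line0 ((pd_contDiffAt (k := 1) hf (by norm_num) i).differentiableAt (by norm_num))
  have := hasDerivAt_sqrt_sum h
  simpa [graphV, gradNormSq] using this

lemma meanCurv_eq {n : ℕ} {f : En n → ℝ} {x : En n} (hf : ContDiffAt ℝ 2 f x) :
    meanCurv f x = (∑ i, pd (pd f i) i x) / graphV f x
      - (∑ i, ∑ j, pd f i x * pd f j x * pd (pd f i) j x) / graphV f x ^ 3 := by
  have hv := graphV_pos f x
  have hdi : ∀ i, DifferentiableAt ℝ (pd f i) x := fun i =>
    (pd_contDiffAt (k := 1) hf (by norm_num) i).differentiableAt (by norm_num)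
  have key : ∀ i, pd (fun y => pd f i y / graphV f y) i x
      = pd (pd f i) i x / graphV f x
        - (∑ j, pd f i x * pd f j x * pd (pd f i) j x) / graphV f x ^ 3 := by
    intro i
    set e : En n := EuclideanSpace.single i 1
    have h1 := (hasDerivAt_line0 (d := e) (hdi i)).div (graphV_line hf e) (by simpa using hv.ne')
    have hdiff : DifferentiableAt ℝ (fun y => pd f i y / graphV f y) x := by
      simp only [div_eq_mul_inv]
      exact (hdi i).mul ((graphV_differentiableAt hf).inv hv.ne')
    have h2 := hasDerivAt_line0 (d := e) hdiff
    have h3 := h2.unique h1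
    have h4 : pd (fun y => pd f i y / graphV f y) i x
      = dd (fun y => pd f i y / graphV f y) e x := rfl
    rw [h4, h3]
    have h5 : ∀ j, dd (pd f j) e x = pd (pd f i) j x := fun j => dd_symm hf _ _
    simp only [h5, zero_smul, add_zero]
    simp_rw [mul_assoc, ← Finset.mul_sum]
    have : (pd f i x) = pd f i x := rfl
    rw [sub_div]
    congr 1
    · field_simp
    · field_simp
  unfold meanCurv
  simp_rw [key]
  rw [Finset.sum_sub_distrib, Finset.sum_div, Finset.sum_div]

/-- trace inequality against the inverse metric -/
lemma trace_ineq {n : ℕ} (B : Fin n → Fin n → ℝ) (p : Fin n → ℝ) (v : ℝ) (hv : 0 < v)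
    (hv2 : v ^ 2 = 1 + ∑ i, p i ^ 2)
    (hB : ∀ d : Fin n → ℝ, ∑ i, ∑ j, d i * d j * B i j ≤ 0) :
    ∑ i, B i i - (∑ i, ∑ j, p i * p j * B i j) / v ^ 2 ≤ 0 := by
  set κ : ℝ := 1 / (v * (v + 1)) with hκ
  set q : ℝ := ∑ i, p i ^ 2 with hq
  have h1 : ∀ k, ∑ i, ∑ j, ((if i = k then 1 else 0) - κ * p k * p i) *
      ((if j = k then 1 else 0) - κ * p k * p j) * B i j
      = B k k - κ * (p k * ∑ j, p j * B k j) - κ * (p k * ∑ i, p i * B i k)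
        + κ ^ 2 * (p k ^ 2 * ∑ i, ∑ j, p i * p j * B i j) := by
    intro k
    have : ∀ i j, ((if i = k then (1:ℝ) else 0) - κ * p k * p i) *
      ((if j = k then 1 else 0) - κ * p k * p j) * B i j
      = (if i = k then (if j = k then B i j else 0) else 0)
        - (if i = k then κ * (p k * (p j * B i j)) else 0)
        - (if j = k then κ * (p k * (p i * B i j)) else 0)
        + κ ^ 2 * (p k ^ 2 * (p i * p j * B i j)) := by
      intro i j; split_ifs <;> ring
    simp_rw [this, Finset.sum_add_distrib, Finset.sum_sub_distrib, ← Finset.mul_sum]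
    congr 1
    congr 1
    · congr 1
      · simp
      · rw [Finset.sum_comm]; simp [Finset.mul_sum]
    · simp [Finset.mul_sum]
  have h2 : ∑ k, (B k k - κ * (p k * ∑ j, p j * B k j) - κ * (p k * ∑ i, p i * B i k)
        + κ ^ 2 * (p k ^ 2 * ∑ i, ∑ j, p i * p j * B i j)) ≤ 0 := by
    apply Finset.sum_nonpos
    intro k _
    rw [← h1 k]
    exact hB _
  rw [Finset.sum_add_distrib, Finset.sum_sub_distrib, Finset.sum_sub_distrib,
    ← Finset.mul_sum, ← Finset.mul_sum, ← Finset.mul_sum, ← Finset.sum_mul] at h2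
  have h3 : ∑ k, p k * ∑ j, p j * B k j = ∑ i, ∑ j, p i * p j * B i j := by
    simp_rw [Finset.mul_sum, mul_assoc]
  have h4 : ∑ k, p k * ∑ i, p i * B i k = ∑ i, ∑ j, p i * p j * B i j := by
    rw [Finset.sum_comm]
    simp_rw [Finset.mul_sum]
    exact Finset.sum_congr rfl fun i _ => Finset.sum_congr rfl fun j _ => by ring
  rw [h3, h4, ← hq] at h2
  set W := ∑ i, ∑ j, p i * p j * B i j
  have hq2 : q = v ^ 2 - 1 := by linarith
  have h5 : W / v ^ 2 = κ * W + κ * W - κ ^ 2 * (q * W) := by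
    rw [hq2, hκ]; field_simp; ring
  linarith

/-- Monotonicity of mean curvature at a touching point. -/
lemma meanCurv_le {n : ℕ} {f g : En n → ℝ} {x : En n} (hf : ContDiffAt ℝ 2 f x)
    (hg : ContDiffAt ℝ 2 g x) (hm : IsLocalMax (fun y => f y - g y) x) :
    graphV f x = graphV g x ∧ meanCurv f x ≤ meanCurv g x := by
  have hfd : fderiv ℝ f x = fderiv ℝ g x := by
    have h := hm.fderiv_eq_zero
    rw [fderiv_fun_sub (hf.differentiableAt (by norm_num)) (hg.differentiableAt (by norm_num))] at h
    exact sub_eq_zero.mp h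
  have hp : ∀ i, pd f i x = pd g i x := fun i => by unfold pd; rw [hfd]
  have hV : graphV f x = graphV g x := by
    unfold graphV gradNormSq; simp_rw [hp]
  refine ⟨hV, ?_⟩
  have hB : ∀ d : Fin n → ℝ, ∑ i, ∑ j, d i * d j * (pd (pd f i) j x - pd (pd g i) j x) ≤ 0 := by
    intro d
    have h1 := dd_dd_nonpos (hf.sub hg) hm (WithLp.toLp 2 d)
    have h2 : dd (dd (fun y => f y - g y) (WithLp.toLp 2 d)) (WithLp.toLp 2 d) x
       = dd (dd f (WithLp.toLp 2 d)) (WithLp.toLp 2 d) x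
        - dd (dd g (WithLp.toLp 2 d)) (WithLp.toLp 2 d) x := by
      have hev : dd (fun y => f y - g y) (WithLp.toLp 2 d) =ᶠ[nhds x]
          fun y => dd f (WithLp.toLp 2 d) y - dd g (WithLp.toLp 2 d) y := by
        filter_upwards [hf.eventually (by simp), hg.eventually (by simp)] with y h1 h2
        unfold dd
        rw [fderiv_fun_sub (h1.differentiableAt (by norm_num)) (h2.differentiableAt (by norm_num))]
        rfl
      rw [dd_congr hev]
      conv_lhs => unfold dd
      rw [fderiv_fun_sub]
      · rfl
      · exact (dd_contDiffAt (k := 1) hf (by norm_num) _).differentiableAt (by norm_num)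
      · exact (dd_contDiffAt (k := 1) hg (by norm_num) _).differentiableAt (by norm_num)
    have h3 : dd (dd (fun y => f y - g y) (WithLp.toLp 2 d)) (WithLp.toLp 2 d) x ≤ 0 := h1
    rw [h2, dd_dd_expand hf, dd_dd_expand hg, ← Finset.sum_sub_distrib] at h3
    simp_rw [← Finset.sum_sub_distrib, ← mul_sub] at h3
    exact h3
  have hv := graphV_pos g x
  have := trace_ineq _ (fun i => pd g i x) (graphV g x) hv (graphV_sq g x) hB
  rw [meanCurv_eq hf, meanCurv_eq hg, hV]
  simp_rw [hp]
  simp_rw [mul_sub, Finset.sum_sub_distrib] at this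
  set a := ∑ i, pd (pd f i) i x
  set b := ∑ i, pd (pd g i) i x
  set a2 := ∑ i, ∑ j, pd g i x * pd g j x * pd (pd f i) j x
  set b2 := ∑ i, ∑ j, pd g i x * pd g j x * pd (pd g i) j x
  have h4 : (a / graphV g x - a2 / graphV g x ^ 3) - (b / graphV g x - b2 / graphV g x ^ 3)
     = (a - b - (a2 - b2) / graphV g x ^ 2) / graphV g x := by
    field_simp; ring
  have h5 : (a - b - (a2 - b2) / graphV g x ^ 2) / graphV g x ≤ 0 :=
    div_nonpos_of_nonpos_of_nonneg this hv.le
  linarith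


lemma scalar_ineq (z q v D trZ Zpp Xpp H : ℝ) (hv : 0 < v) (hz : 0 < z) (hq : 1 ≤ q)
    (hv2 : v ^ 2 = 1 + q) (hX : Xpp = - q ^ 2)
    (hH : H = D / v - Xpp / v ^ 3) (hHpos : 0 < H)
    (hB : trZ - z * (q - D) - (Zpp - z * (q ^ 2 - Xpp)) / v ^ 2 ≤ 0) :
    (trZ * v - D * (-(z * q) / v)) / v ^ 2
      - ((Zpp - 2 * z * Xpp) * v ^ 3 - Xpp * (3 * v ^ 2 * (-(z * q) / v))) / (v ^ 3) ^ 2 ≤ 0 := by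
  have e1 : (trZ * v - D * (-(z * q) / v)) / v ^ 2
      - ((Zpp - 2 * z * Xpp) * v ^ 3 - Xpp * (3 * v ^ 2 * (-(z * q) / v))) / (v ^ 3) ^ 2
      = (trZ - z * (q - D) - (Zpp - z * (q ^ 2 - Xpp)) / v ^ 2) / v
        + (z * (q * (1 - q) / v ^ 5) - z * H / v ^ 2) := by
    rw [hH, hX]
    have hq' : q = v ^ 2 - 1 := by linarith
    rw [hq']
    field_simp
    ring
  rw [e1]
  have h1 := div_nonpos_of_nonpos_of_nonneg hB hv.le
  have h2 : z * (q * (1 - q) / v ^ 5) ≤ 0 := by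
    apply mul_nonpos_of_nonneg_of_nonpos hz.le
    apply div_nonpos_of_nonpos_of_nonneg _ (by positivity)
    nlinarith
  have h3 : 0 ≤ z * H / v ^ 2 := by positivity
  linarith

lemma meanCurv_differentiableAt {n : ℕ} {f : En n → ℝ} {x : En n} (hf : ContDiffAt ℝ 3 f x) :
    DifferentiableAt ℝ (meanCurv f) x := by
  have h2 : ContDiffAt ℝ 2 f x := hf.of_le (by norm_num)
  have hev : meanCurv f =ᶠ[nhds x] fun y => (∑ i, pd (pd f i) i y) / graphV f y
      - (∑ i, ∑ j, pd f i y * pd f j y * pd (pd f i) j y) / graphV f y ^ 3 := by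
    filter_upwards [h2.eventually (by simp)] with y hy using meanCurv_eq hy
  rw [hev.differentiableAt_iff]
  have hd1 : ∀ i, DifferentiableAt ℝ (pd f i) x := fun i =>
    (pd_contDiffAt (k := 1) h2 (by norm_num) i).differentiableAt (by norm_num)
  have hd2 : ∀ i j, DifferentiableAt ℝ (pd (pd f i) j) x := fun i j =>
    (pd_contDiffAt (k := 1) (pd_contDiffAt (k := 2) hf (by norm_num) i)
      (by norm_num) j).differentiableAt (by norm_num)
  have hv := graphV_differentiableAt h2
  have hv0 := (graphV_pos f x).ne'
  simp only [div_eq_mul_inv]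
  have hi1 : DifferentiableAt ℝ (fun y => (graphV f y)⁻¹) x := hv.inv hv0
  have hi2 : DifferentiableAt ℝ (fun y => (graphV f y ^ 3)⁻¹) x := (hv.pow 3).inv (pow_ne_zero 3 hv0)
  fun_prop

/-- At a critical point of `log ∂ₑu + u` the mean curvature decreases in direction `e`. -/
lemma meanCurv_dd_nonpos {n : ℕ} {f : En n → ℝ} {x e : En n} {z : ℝ} (hf : ContDiffAt ℝ 3 f x)
    (hz : 1 ≤ z) (he : ∀ i, pd f i x = z * e i) (he1 : ∑ i, e i ^ 2 = 1)
    (hcrit : ∀ d, dd (dd f e) d x = - z * dd f d x)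
    (hsec : ∀ d, dd (dd (dd f e) d) d x ≤ z * ((dd f d x) ^ 2 - dd (dd f d) d x))
    (hH : 0 < meanCurv f x) :
    dd (meanCurv f) e x ≤ 0 := by
  have h2 : ContDiffAt ℝ 2 f x := hf.of_le (by norm_num)
  have hz0 : 0 < z := by linarith
  have hz2 : ContDiffAt ℝ 2 (dd f e) x := dd_contDiffAt hf (by norm_num) e
  have hd1 : ∀ i, DifferentiableAt ℝ (pd f i) x := fun i =>
    (pd_contDiffAt (k := 1) h2 (by norm_num) i).differentiableAt (by norm_num)
  have hd2 : ∀ i j, DifferentiableAt ℝ (pd (pd f i) j) x := fun i j =>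
    (pd_contDiffAt (k := 1) (pd_contDiffAt (k := 2) hf (by norm_num) i)
      (by norm_num) j).differentiableAt (by norm_num)
  set p : Fin n → ℝ := fun i => pd f i x with hp
  set X : Fin n → Fin n → ℝ := fun i j => pd (pd f i) j x with hX
  set Z : Fin n → Fin n → ℝ := fun i j => pd (pd (dd f e) i) j x with hZ
  set q : ℝ := ∑ i, p i ^ 2 with hq
  set v := graphV f x with hvdef
  have hv : 0 < v := graphV_pos f x
  have hv2 : v ^ 2 = 1 + q := graphV_sq f x
  have hqz : q = z ^ 2 := by
    rw [hq]; simp_rw [hp, he, mul_pow]; rw [← Finset.mul_sum, he1, mul_one]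
  -- derivatives along the line
  have hP' : ∀ i, dd (pd f i) e x = - z * p i := by
    intro i
    have : dd (pd f i) e x = dd (dd f e) (EuclideanSpace.single i 1) x := dd_symm h2 _ _
    rw [this, hcrit]; rfl
  have hX' : ∀ i j, dd (pd (pd f i) j) e x = Z i j := by
    intro i j
    have a1 : dd (pd (pd f i) j) e x = dd (dd (pd f i) e) (EuclideanSpace.single j 1) x :=
      dd_symm (pd_contDiffAt (k := 2) hf (by norm_num) i) _ _
    have a2 : dd (pd f i) e =ᶠ[nhds x] pd (dd f e) i := by
      filter_upwards [h2.eventually (by simp)] with y hy using dd_symm hy _ _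
    rw [a1, dd_congr a2]; rfl
  have hXp : ∀ i, ∑ j, p j * X i j = - q * p i := by
    intro i
    have a1 := dd_expand (pd f i) e x
    rw [hP'] at a1
    have : ∑ j, p j * X i j = z * ∑ j, e j * pd (pd f i) j x := by
      rw [Finset.mul_sum]; refine Finset.sum_congr rfl fun j _ => ?_
      simp only [hp, he, hX]; ring
    rw [this, ← a1, hqz]; ring
  set Xpp : ℝ := ∑ i, ∑ j, p i * p j * X i j with hXpp
  have hXppv : Xpp = - q ^ 2 := by
    rw [hXpp]
    simp_rw [mul_assoc, ← Finset.mul_sum, hXp]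
    rw [pow_two, ← neg_mul]
    conv_rhs => rw [hq]
    rw [← hq, Finset.mul_sum]
    exact Finset.sum_congr rfl fun i _ => by ring
  have hl1 : ∀ i, HasDerivAt (fun r : ℝ => pd f i (x + r • e)) (-z * p i) 0 := fun i => by
    rw [← hP']; exact hasDerivAt_line0 (hd1 i)
  have hl2 : ∀ i j, HasDerivAt (fun r : ℝ => pd (pd f i) j (x + r • e)) (Z i j) 0 := fun i j => by
    rw [← hX']; exact hasDerivAt_line0 (hd2 i j)
  have hlv : HasDerivAt (fun r : ℝ => graphV f (x + r • e)) (-(z * q) / v) 0 := by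
    refine (graphV_line h2 e).congr_deriv ?_
    congr 1
    simp_rw [hP']
    rw [hq, Finset.mul_sum, ← Finset.sum_neg_distrib]
    exact Finset.sum_congr rfl fun i _ => by simp only [hp]; ring
  have hltr : HasDerivAt (fun r : ℝ => ∑ i, pd (pd f i) i (x + r • e)) (∑ i, Z i i) 0 :=
    HasDerivAt.fun_sum fun i _ => hl2 i i
  have hlpp : HasDerivAt (fun r : ℝ => ∑ i, ∑ j, pd f i (x + r • e) * pd f j (x + r • e)
      * pd (pd f i) j (x + r • e)) ((∑ i, ∑ j, p i * p j * Z i j) - 2 * z * Xpp) 0 := by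
    have : HasDerivAt (fun r : ℝ => ∑ i, ∑ j, pd f i (x + r • e) * pd f j (x + r • e)
      * pd (pd f i) j (x + r • e)) (∑ i, ∑ j, (p i * p j * Z i j - 2 * z * (p i * p j * X i j))) 0 := by
      refine HasDerivAt.fun_sum fun i _ => HasDerivAt.fun_sum fun j _ => ?_
      refine (((hl1 i).mul (hl1 j)).mul (hl2 i j)).congr_deriv ?_
      simp [hp, hX]; ring
    refine this.congr_deriv ?_
    simp_rw [Finset.sum_sub_distrib, ← Finset.mul_sum]
    rfl
  have hlH : HasDerivAt (fun r : ℝ => meanCurv f (x + r • e))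
     (((∑ i, Z i i) * v - (∑ i, X i i) * (-(z * q) / v)) / v ^ 2
      - (((∑ i, ∑ j, p i * p j * Z i j) - 2 * z * Xpp) * v ^ 3
        - Xpp * (3 * v ^ 2 * (-(z * q) / v))) / (v ^ 3) ^ 2) 0 := by
    have a1 := (hltr.div hlv (by simpa using hv.ne')).sub
      (hlpp.div (hlv.pow 3) (by simpa using hv.ne'))
    have hev : (fun r : ℝ => meanCurv f (x + r • e)) =ᶠ[nhds 0]
      (fun r : ℝ => (∑ i, pd (pd f i) i (x + r • e)) / graphV f (x + r • e)
        - (∑ i, ∑ j, pd f i (x + r • e) * pd f j (x + r • e)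
      * pd (pd f i) j (x + r • e)) / graphV f (x + r • e) ^ 3) := by
      filter_upwards [(line_tendsto x e).eventually (h2.eventually (by simp))] with r hr
        using meanCurv_eq hr
    refine HasDerivAt.congr_of_eventuallyEq ?_ hev
    refine a1.congr_deriv ?_
    simp [hXpp, hX, hp, hvdef]
  rw [(hasDerivAt_line0 (meanCurv_differentiableAt hf)).unique hlH]
  have hB : ∀ d : Fin n → ℝ, ∑ i, ∑ j, d i * d j * (Z i j - z * (p i * p j - X i j)) ≤ 0 := by
    intro d
    have h1 := hsec (WithLp.toLp 2 d)
    rw [dd_dd_expand hz2, dd_dd_expand h2, dd_expand] at h1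
    have e1 : (∑ i, (WithLp.toLp 2 d : En n) i * pd f i x) ^ 2
       = ∑ i, ∑ j, d i * d j * (p i * p j) := by
      rw [pow_two, Finset.sum_mul_sum]
      exact Finset.sum_congr rfl fun i _ => Finset.sum_congr rfl fun j _ => by
        simp only [hp]; ring
    rw [e1] at h1
    have e2 : ∑ i, ∑ j, d i * d j * (Z i j - z * (p i * p j - X i j))
      = (∑ i, ∑ j, d i * d j * Z i j) - z * ((∑ i, ∑ j, d i * d j * (p i * p j))
         - ∑ i, ∑ j, d i * d j * X i j) := by
      simp_rw [← Finset.sum_sub_distrib, Finset.mul_sum, ← Finset.sum_sub_distrib]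
      exact Finset.sum_congr rfl fun i _ => Finset.sum_congr rfl fun j _ => by ring
    rw [e2]
    have h1' : (∑ i, ∑ j, d i * d j * Z i j) ≤ z * ((∑ i, ∑ j, d i * d j * (p i * p j))
         - ∑ i, ∑ j, d i * d j * X i j) := h1
    linarith
  have htr := trace_ineq _ p v hv hv2 hB
  apply scalar_ineq z q v (∑ i, X i i) (∑ i, Z i i) (∑ i, ∑ j, p i * p j * Z i j) Xpp
    (meanCurv f x) hv hz0 (by rw [hqz]; nlinarith) hv2 hXppv (meanCurv_eq h2) hH
  have e3 : ∑ i, (Z i i - z * (p i * p i - X i i)) = (∑ i, Z i i) - z * (q - ∑ i, X i i) := by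
    rw [hq, ← Finset.sum_sub_distrib, Finset.mul_sum, ← Finset.sum_sub_distrib]
    exact Finset.sum_congr rfl fun i _ => by ring
  have e4 : ∑ i, ∑ j, p i * p j * (Z i j - z * (p i * p j - X i j))
      = (∑ i, ∑ j, p i * p j * Z i j) - z * (q ^ 2 - Xpp) := by
    have : q ^ 2 = ∑ i, ∑ j, p i * p j * (p i * p j) := by
      rw [pow_two, hq, Finset.sum_mul_sum]
      exact Finset.sum_congr rfl fun i _ => Finset.sum_congr rfl fun j _ => by ring
    rw [this, hXpp]
    simp_rw [← Finset.sum_sub_distrib, Finset.mul_sum, ← Finset.sum_sub_distrib]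
    exact Finset.sum_congr rfl fun i _ => Finset.sum_congr rfl fun j _ => by ring
  rw [e3, e4] at htr
  exact htr

/-- Comparison principle. -/
lemma comparison {n : ℕ} (Q : Set (En n)) (alp s : En n → ℝ) (hQo : IsOpen Q)
    (hQb : Bornology.IsBounded Q) (halp : ∀ x ∈ Q, 0 ≤ alp x)
    (T : ℝ) (f g : En n → ℝ → ℝ)
    (hfc : ContinuousOn (fun p : En n × ℝ => f p.1 p.2) (closure Q ×ˢ Icc 0 T))
    (hgc : ContinuousOn (fun p : En n × ℝ => g p.1 p.2) (closure Q ×ˢ Icc 0 T))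
    (hf2 : ∀ x ∈ Q, ∀ t ∈ Ioc 0 T, ContDiffAt ℝ 2 (fun y => f y t) x)
    (hg2 : ∀ x ∈ Q, ∀ t ∈ Ioc 0 T, ContDiffAt ℝ 2 (fun y => g y t) x)
    (hft : ∀ x ∈ Q, ∀ t ∈ Ioc 0 T, DifferentiableAt ℝ (f x) t)
    (hgt : ∀ x ∈ Q, ∀ t ∈ Ioc 0 T, DifferentiableAt ℝ (g x) t)
    (hfH : ∀ x ∈ Q, ∀ t ∈ Ioc 0 T, 0 ≤ meanCurv (fun y => f y t) x)
    (hsub : ∀ x ∈ Q, ∀ t ∈ Ioc 0 T, deriv (f x) t ≤ Gop alp (fun y => f y t) x - s x)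
    (hsup : ∀ x ∈ Q, ∀ t ∈ Ioc 0 T, Gop alp (fun y => g y t) x - s x ≤ deriv (g x) t)
    (h0 : ∀ x ∈ closure Q, f x 0 ≤ g x 0)
    (hb : ∀ x ∈ frontier Q, ∀ t ∈ Icc 0 T, f x t ≤ g x t) :
    ∀ x ∈ closure Q, ∀ t ∈ Icc 0 T, f x t ≤ g x t := by
  intro x1 hx1 t1 ht1
  have hcl : IsCompact (closure Q) := Metric.isCompact_of_isClosed_isBounded isClosed_closure hQb.closure
  have hK : IsCompact (closure Q ×ˢ Icc (0:ℝ) T) := hcl.prod isCompact_Icc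
  have main : ∀ ε > 0, f x1 t1 - g x1 t1 - ε * t1 ≤ 0 := by
    intro ε hε
    obtain ⟨⟨x0, t0⟩, ⟨hx0, ht0⟩, hmax⟩ := hK.exists_isMaxOn ⟨(x1, t1), hx1, ht1⟩
      ((hfc.sub hgc).sub (f := fun p : En n × ℝ => f p.1 p.2 - g p.1 p.2)
        (g := fun p : En n × ℝ => ε * p.2) (by fun_prop))
    have hmax' : ∀ x ∈ closure Q, ∀ t ∈ Icc 0 T,
        f x t - g x t - ε * t ≤ f x0 t0 - g x0 t0 - ε * t0 :=
      fun x hx t ht => hmax (show (x, t) ∈ closure Q ×ˢ Icc (0:ℝ) T from ⟨hx, ht⟩)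
    simp only at hx0 ht0
    refine (hmax' x1 hx1 t1 ht1).trans ?_
    by_cases hxQ : x0 ∈ Q
    swap
    · have : x0 ∈ frontier Q := by rw [frontier, hQo.interior_eq]; exact ⟨hx0, hxQ⟩
      have := hb x0 this t0 ht0
      nlinarith [ht0.1]
    rcases eq_or_lt_of_le ht0.1 with ht | ht
    · rw [← ht]; have := h0 x0 hx0; linarith
    exfalso
    have ht0' : t0 ∈ Ioc 0 T := ⟨ht, ht0.2⟩
    have hloc : IsLocalMax (fun y => f y t0 - g y t0) x0 := by
      filter_upwards [hQo.mem_nhds hxQ] with y hy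
      have := hmax' y (subset_closure hy) t0 ht0
      linarith
    obtain ⟨hV, hH⟩ := meanCurv_le (hf2 x0 hxQ t0 ht0') (hg2 x0 hxQ t0 ht0') hloc
    have hG : Gop alp (fun y => f y t0) x0 ≤ Gop alp (fun y => g y t0) x0 := by
      unfold Gop
      rw [hV]
      exact mul_le_mul_of_nonneg_left
        (Real.rpow_le_rpow (hfH x0 hxQ t0 ht0') hH (halp x0 hxQ)) (graphV_pos _ _).le
    have hder : HasDerivAt (fun t => f x0 t - g x0 t - ε * t)
        (deriv (f x0) t0 - deriv (g x0) t0 - ε * 1) t0 :=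
      ((hft x0 hxQ t0 ht0').hasDerivAt.sub (hgt x0 hxQ t0 ht0').hasDerivAt).sub
        ((hasDerivAt_id t0).const_mul ε)
    have hnn : 0 ≤ deriv (f x0) t0 - deriv (g x0) t0 - ε * 1 := by
      have hsl := hder.hasDerivWithinAt (s := Iio t0)
      rw [hasDerivWithinAt_iff_tendsto_slope' (by simp)] at hsl
      refine ge_of_tendsto hsl ?_
      filter_upwards [Ioo_mem_nhdsLT ht] with t htt
      rw [slope_def_field]
      apply div_nonneg_of_nonpos
      · have := hmax' x0 hx0 t ⟨htt.1.le, htt.2.le.trans ht0.2⟩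
        linarith
      · linarith [htt.2]
    have h1 := hsub x0 hxQ t0 ht0'
    have h2 := hsup x0 hxQ t0 ht0'
    linarith
  by_contra hcon
  push Not at hcon
  have hT : 0 ≤ t1 := ht1.1
  have := main ((f x1 t1 - g x1 t1) / (2 * (1 + t1))) (by apply div_pos <;> linarith)
  have h3 : (f x1 t1 - g x1 t1) / (2 * (1 + t1)) * t1 ≤ (f x1 t1 - g x1 t1) / 2 := by
    rw [div_mul_eq_mul_div, div_le_div_iff₀ (by linarith) (by norm_num)]
    nlinarith
  linarith


namespace AuxSetting
variable {n : ℕ} (S : AuxSetting n)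

lemma isOpen_Q : IsOpen S.Q := by
  rw [S.hQdef]; exact isOpen_lt S.hrho.continuous continuous_const

lemma isCompact_K : IsCompact (closure S.Q) :=
  Metric.isCompact_of_isClosed_isBounded isClosed_closure S.hbdd.closure

lemma mem_frontier {x : En n} (hx : x ∈ closure S.Q) (hxQ : x ∉ S.Q) : x ∈ frontier S.Q := by
  rw [frontier, S.isOpen_Q.interior_eq]; exact ⟨hx, hxQ⟩

lemma nhds_K {x : En n} (hx : x ∈ S.Q) : closure S.Q ∈ nhds x :=
  Filter.mem_of_superset (S.isOpen_Q.mem_nhds hx) subset_closure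

lemma inward {x d : En n} (hx : x ∈ frontier S.Q) (hd : fderiv ℝ S.rho x d < 0) :
    ∀ᶠ r in nhdsWithin (0:ℝ) (Ioi 0), x + r • d ∈ S.Q := by
  have h0 : S.rho x = 0 := by have := S.hfront ▸ hx; exact this
  have h1 : HasDerivAt (fun r : ℝ => S.rho (x + r • d)) (fderiv ℝ S.rho x d) 0 :=
    hasDerivAt_line0 ((S.hrho.differentiable (by simp)) x)
  have hsl := h1.hasDerivWithinAt (s := Ioi 0)
  rw [hasDerivWithinAt_iff_tendsto_slope' (by simp)] at hsl
  filter_upwards [hsl.eventually (gt_mem_nhds hd), self_mem_nhdsWithin] with r hr hr0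
  rw [slope_def_field] at hr
  simp only [zero_smul, add_zero, h0, sub_zero] at hr
  rw [S.hQdef]
  have hr0' : 0 < r := hr0
  rw [div_neg_iff] at hr
  rcases hr with h | h
  · linarith [h.2]
  · exact h.1

lemma exists_inward {x : En n} (hx : x ∈ frontier S.Q) : ∃ d, fderiv ℝ S.rho x d < 0 := by
  have h := S.hgrad x hx
  by_contra hcon
  push Not at hcon
  apply h
  ext d
  have h1 := hcon d
  have h2 := hcon (-d)
  simp at h2 ⊢
  linarith

lemma uniqueDiff : UniqueDiffOn ℝ (closure S.Q) := by
  intro x hx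
  by_cases hxQ : x ∈ S.Q
  · exact uniqueDiffWithinAt_of_mem_nhds (S.nhds_K hxQ)
  have hxf := S.mem_frontier hx hxQ
  refine ⟨?_, by simpa using hx⟩
  obtain ⟨d0, hd0⟩ := S.exists_inward hxf
  have hsub : {d | fderiv ℝ S.rho x d < 0} ⊆ tangentConeAt ℝ (closure S.Q) x := by
    intro d hd
    refine mem_tangentConeAt_of_frequently (nhdsWithin (0:ℝ) (Ioi 0)) (fun r => r⁻¹)
      (fun r => r • d) ?_ ?_ ?_
    · have : Continuous (fun r : ℝ => r • d) := by fun_prop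
      have := this.tendsto 0
      simp only [zero_smul] at this
      exact this.mono_left nhdsWithin_le_nhds
    · exact ((S.inward hxf hd).mono fun r hr => subset_closure hr).frequently
    · refine tendsto_const_nhds.congr' ?_
      filter_upwards [self_mem_nhdsWithin] with r hr
      have : r ≠ 0 := ne_of_gt hr
      rw [smul_smul, inv_mul_cancel₀ this, one_smul]
  have htop : Submodule.span ℝ {d : En n | fderiv ℝ S.rho x d < 0} = ⊤ := by
    apply Submodule.eq_top_of_nonempty_interior'
    have ho : IsOpen {d : En n | fderiv ℝ S.rho x d < 0} :=
      isOpen_lt (fderiv ℝ S.rho x).continuous continuous_const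
    exact ⟨d0, mem_interior.mpr ⟨_, Submodule.subset_span, ho, hd0⟩⟩
  have : Submodule.span ℝ (tangentConeAt ℝ (closure S.Q) x) = ⊤ := by
    rw [eq_top_iff, ← htop]; exact Submodule.span_mono hsub
  rw [this]; simp

lemma lateral {x : En n} (hx : x ∈ frontier S.Q) {f f0 : En n → ℝ} {A A0 : En n →L[ℝ] ℝ} {k : ℝ}
    (hA : HasFDerivWithinAt f A (closure S.Q) x) (hA0 : HasFDerivWithinAt f0 A0 (closure S.Q) x)
    (h1 : ∀ y ∈ closure S.Q, f0 y + k ≤ f y) (h2 : ∀ y ∈ closure S.Q, f y ≤ k)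
    (hfx : f x = k) (hf0x : f0 x = 0) : ‖A‖ ≤ ‖A0‖ := by
  have key : ∀ d, fderiv ℝ S.rho x d < 0 → A0 d ≤ A d ∧ A d ≤ 0 := by
    intro d hd
    have hev := S.inward hx hd
    obtain ⟨δ, hδ, hsub⟩ := (mem_nhdsGT_iff_exists_Ioo_subset).mp hev
    have hδ' : 0 < δ := hδ
    have hline : HasDerivWithinAt (fun r : ℝ => x + r • d) d (Ioo 0 δ) 0 := by
      have : HasDerivAt (fun r : ℝ => x + r • d) d 0 := by
        simpa using ((hasDerivAt_id (0:ℝ)).smul_const d).const_add x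
      exact this.hasDerivWithinAt
    have hmaps : MapsTo (fun r : ℝ => x + r • d) (Ioo 0 δ) (closure S.Q) :=
      fun r hr => subset_closure (hsub hr)
    have hx0 : x = x + (0:ℝ) • d := by simp
    have g1 : HasDerivWithinAt (fun r : ℝ => f (x + r • d)) (A d) (Ioo 0 δ) 0 := by
      rw [hx0] at hA
      exact hA.comp_hasDerivWithinAt 0 hline hmaps
    have g0 : HasDerivWithinAt (fun r : ℝ => f0 (x + r • d)) (A0 d) (Ioo 0 δ) 0 := by
      rw [hx0] at hA0
      exact hA0.comp_hasDerivWithinAt 0 hline hmaps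
    rw [hasDerivWithinAt_iff_tendsto_slope' (by simp)] at g0 g1
    have hne : (nhdsWithin (0:ℝ) (Ioo 0 δ)).NeBot := by
      rw [nhdsWithin_Ioo_eq_nhdsGT hδ']; infer_instance
    constructor
    · refine le_of_tendsto_of_tendsto g0 g1 ?_
      filter_upwards [self_mem_nhdsWithin] with r hr
      simp only [slope_def_field, zero_smul, add_zero, hfx, hf0x]
      have := h1 _ (hmaps hr)
      simp only at this
      apply div_le_div_of_nonneg_right _ (by linarith [hr.1])
      linarith
    · refine le_of_tendsto g1 ?_
      filter_upwards [self_mem_nhdsWithin] with r hr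
      simp only [slope_def_field, zero_smul, add_zero, hfx]
      have := h2 _ (hmaps hr)
      simp only at this
      apply div_nonpos_of_nonpos_of_nonneg
      · linarith
      · linarith [hr.1]
  have key2 : ∀ d, fderiv ℝ S.rho x d < 0 → |A d| ≤ ‖A0‖ * ‖d‖ := by
    intro d hd
    obtain ⟨a, b⟩ := key d hd
    rw [abs_of_nonpos b]
    have := A0.le_opNorm d
    rw [Real.norm_eq_abs] at this
    have := neg_abs_le (A0 d)
    linarith
  have key3 : ∀ d, fderiv ℝ S.rho x d ≤ 0 → |A d| ≤ ‖A0‖ * ‖d‖ := by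
    intro d hd
    obtain ⟨d0, hd0⟩ := S.exists_inward hx
    have c1 : Filter.Tendsto (fun r : ℝ => |A (d + r • d0)|) (nhdsWithin 0 (Ioi 0)) (nhds (|A d|)) := by
      have : Continuous (fun r : ℝ => |A (d + r • d0)|) := by fun_prop
      have := this.tendsto 0
      simp only [zero_smul, add_zero] at this
      exact this.mono_left nhdsWithin_le_nhds
    have c2 : Filter.Tendsto (fun r : ℝ => ‖A0‖ * ‖d + r • d0‖) (nhdsWithin 0 (Ioi 0))
        (nhds (‖A0‖ * ‖d‖)) := by
      have : Continuous (fun r : ℝ => ‖A0‖ * ‖d + r • d0‖) := by fun_prop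
      have := this.tendsto 0
      simp only [zero_smul, add_zero] at this
      exact this.mono_left nhdsWithin_le_nhds
    refine le_of_tendsto_of_tendsto c1 c2 ?_
    filter_upwards [self_mem_nhdsWithin] with r hr
    apply key2
    have hr' : 0 < r := hr
    simp only [map_add, map_smul, smul_eq_mul]
    nlinarith
  refine A.opNorm_le_bound (norm_nonneg _) fun d => ?_
  rw [Real.norm_eq_abs]
  rcases le_total (fderiv ℝ S.rho x d) 0 with h | h
  · exact key3 d h
  · have := key3 (-d) (by simpa using h)
    simpa using this

lemma bounds_of_contDiffOn {g : En n → ℝ} (hg : ContDiffOn ℝ (⊤ : ℕ∞) g (closure S.Q)) :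
    ∃ C, 0 ≤ C ∧ ∀ x ∈ closure S.Q, |g x| ≤ C ∧ ‖fderivWithin ℝ g (closure S.Q) x‖ ≤ C := by
  obtain ⟨C1, h1⟩ := S.isCompact_K.exists_bound_of_continuousOn hg.continuousOn
  obtain ⟨C2, h2⟩ := S.isCompact_K.exists_bound_of_continuousOn
    (hg.continuousOn_fderivWithin S.uniqueDiff (by simp))
  refine ⟨max 0 (max C1 C2), le_max_left _ _, fun x hx => ⟨?_, ?_⟩⟩
  · exact (h1 x hx).trans ((le_max_left _ _).trans (le_max_right _ _))
  · exact (h2 x hx).trans ((le_max_right _ _).trans (le_max_right _ _))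

lemma exists_G0_ext : ∃ Gw : En n → ℝ, ContDiffOn ℝ (⊤ : ℕ∞) Gw (closure S.Q) ∧
    ∀ x ∈ S.Q, Gop S.alp S.u0 x = Gw x := by
  set K := closure S.Q with hK
  have hu := S.uniqueDiff
  set e : Fin n → En n := fun i => EuclideanSpace.single i 1
  set P : Fin n → En n → ℝ := fun i y => fderivWithin ℝ S.u0 K y (e i) with hP
  set V : En n → ℝ := fun y => Real.sqrt (1 + ∑ i, P i y ^ 2) with hV
  set W : Fin n → En n → ℝ := fun i y => P i y / V y with hW
  set Hw : En n → ℝ := fun y => ∑ i, fderivWithin ℝ (W i) K y (e i) with hHw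
  have cdw : ∀ (g : En n → ℝ) (d : En n), ContDiffOn ℝ (⊤ : ℕ∞) g K →
      ContDiffOn ℝ (⊤ : ℕ∞) (fun y => fderivWithin ℝ g K y d) K := fun g d hg =>
    (hg.fderivWithin hu (by simp)).clm_apply contDiffOn_const
  have cP : ∀ i, ContDiffOn ℝ (⊤ : ℕ∞) (P i) K := fun i => cdw _ _ S.hu0_smooth
  have hVpos : ∀ y, 0 < V y := fun y => by simp only [hV]; positivity
  have cV : ContDiffOn ℝ (⊤ : ℕ∞) V K := by
    apply ContDiffOn.sqrt
    · exact contDiffOn_const.add (ContDiffOn.sum fun i _ => (cP i).pow 2)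
    · intro x _; positivity
  have cW : ∀ i, ContDiffOn ℝ (⊤ : ℕ∞) (W i) K := fun i =>
    (cP i).div cV fun x _ => (hVpos x).ne'
  have cH : ContDiffOn ℝ (⊤ : ℕ∞) Hw K := ContDiffOn.sum fun i _ => cdw _ _ (cW i)
  have eP : ∀ i, ∀ x ∈ S.Q, pd S.u0 i x = P i x := fun i x hx => by
    simp only [hP, pd]; rw [fderivWithin_of_mem_nhds (S.nhds_K hx)]
  have eV : ∀ x ∈ S.Q, graphV S.u0 x = V x := fun x hx => by
    simp only [graphV, gradNormSq, hV]; simp_rw [eP _ x hx]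
  have eH : ∀ x ∈ S.Q, meanCurv S.u0 x = Hw x := fun x hx => by
    simp only [meanCurv, hHw]
    refine Finset.sum_congr rfl fun i _ => ?_
    rw [fderivWithin_of_mem_nhds (S.nhds_K hx)]
    simp only [pd]
    have : (fun y => fderiv ℝ S.u0 y (EuclideanSpace.single i 1) / graphV S.u0 y)
        =ᶠ[nhds x] W i := by
      filter_upwards [S.isOpen_Q.mem_nhds hx] with y hy
      rw [eV y hy]; simp only [hW]; rw [← eP i y hy]; rfl
    rw [this.fderiv_eq]
  have hH0 : ∀ x ∈ K, 0 ≤ Hw x := by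
    intro x hx
    refine ContinuousWithinAt.closure_le (s := S.Q) (f := fun _ => (0:ℝ)) hx
      continuousWithinAt_const ((cH.continuousOn x hx).mono subset_closure) ?_
    intro y hy
    rw [← eH y hy]; exact (S.hu0_H y (subset_closure hy)).le
  have hcG : ContinuousOn (fun x => V x * Hw x ^ S.alp x) K := by
    intro x hx
    refine (cV.continuousOn x hx).mul ?_
    exact (cH.continuousOn x hx).rpow (S.halp_smooth.continuousOn x hx) (Or.inr (S.halp_pos x hx))
  have hHpos : ∀ x ∈ K, Hw x ≠ 0 := by
    intro x hx h0
    have : S.c ≤ V x * Hw x ^ S.alp x := by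
      refine ContinuousWithinAt.closure_le (s := S.Q) (f := fun _ => S.c)
        (g := fun x => V x * Hw x ^ S.alp x) hx
        continuousWithinAt_const ((hcG x hx).mono subset_closure) ?_
      intro y hy
      rw [← eH y hy, ← eV y hy]; exact S.hGc y (subset_closure hy)
    rw [h0, Real.zero_rpow (S.halp_pos x hx).ne', mul_zero] at this
    linarith [S.hc]
  refine ⟨fun x => V x * Hw x ^ S.alp x, cV.mul (cH.rpow S.halp_smooth hHpos), ?_⟩
  intro x hx
  change Gop S.alp S.u0 x = V x * Hw x ^ S.alp x
  rw [← eH x hx, ← eV x hx]; rfl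

/-- the source term -/
def src (x : En n) : ℝ := S.xi x * (Gop S.alp S.u0 x - S.c)

lemma constants : ∃ M a : ℝ, 0 < a ∧ 0 < M ∧ S.c ≤ M ∧
    (∀ x ∈ S.Q, Gop S.alp S.u0 x ≤ M) ∧ (∀ x ∈ S.Q, a ≤ S.alp x) ∧
    (∀ x ∈ S.Q, ‖fderiv ℝ S.alp x‖ ≤ M) ∧
    (∀ x ∈ S.Q, DifferentiableAt ℝ S.src x ∧ ‖fderiv ℝ S.src x‖ ≤ M) ∧
    (∀ x ∈ closure S.Q, |S.u0 x| ≤ M ∧ ‖fderivWithin ℝ S.u0 (closure S.Q) x‖ ≤ M) := by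
  obtain ⟨Gw, hGw, hGe⟩ := S.exists_G0_ext
  obtain ⟨C1, hC1, h1⟩ := S.bounds_of_contDiffOn hGw
  obtain ⟨C2, hC2, h2⟩ := S.bounds_of_contDiffOn S.halp_smooth
  have hs : ContDiffOn ℝ (⊤ : ℕ∞) (fun x => S.xi x * (Gw x - S.c)) (closure S.Q) :=
    S.hxi_smooth.mul (hGw.sub contDiffOn_const)
  obtain ⟨C3, hC3, h3⟩ := S.bounds_of_contDiffOn hs
  obtain ⟨C4, hC4, h4⟩ := S.bounds_of_contDiffOn S.hu0_smooth
  have ha : ∃ a : ℝ, 0 < a ∧ ∀ x ∈ S.Q, a ≤ S.alp x := by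
    rcases (closure S.Q).eq_empty_or_nonempty with h | h
    · refine ⟨1, one_pos, fun x hx => ?_⟩
      have := subset_closure hx
      rw [h] at this; exact absurd this (by simp)
    · obtain ⟨x0, hx0, hmin⟩ := S.isCompact_K.exists_isMinOn h S.halp_smooth.continuousOn
      exact ⟨S.alp x0, S.halp_pos x0 hx0, fun x hx => hmin (subset_closure hx)⟩
  obtain ⟨a, ha, hal⟩ := ha
  have hc := S.hc
  refine ⟨C1 + C2 + C3 + C4 + S.c, a, ha, by linarith, by linarith, ?_, hal, ?_, ?_, ?_⟩
  · intro x hx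
    rw [hGe x hx]
    have := (h1 x (subset_closure hx)).1
    linarith [le_abs_self (Gw x)]
  · intro x hx
    have := (h2 x (subset_closure hx)).2
    rw [fderivWithin_of_mem_nhds (S.nhds_K hx)] at this
    linarith
  · intro x hx
    have hev : S.src =ᶠ[nhds x] fun x => S.xi x * (Gw x - S.c) := by
      filter_upwards [S.isOpen_Q.mem_nhds hx] with y hy
      simp only [src]; rw [hGe y hy]
    have := (h3 x (subset_closure hx)).2
    rw [fderivWithin_of_mem_nhds (S.nhds_K hx)] at this
    rw [hev.differentiableAt_iff, hev.fderiv_eq]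
    exact ⟨((hs x (subset_closure hx)).contDiffAt (S.nhds_K hx)).differentiableAt (by simp),
      by linarith⟩
  · intro x hx
    have := h4 x hx
    exact ⟨by linarith [this.1], by linarith [this.2]⟩

end AuxSetting


lemma pd_add_const {n : ℕ} (f : En n → ℝ) (k : ℝ) (i : Fin n) :
    pd (fun y => f y + k) i = pd f i := by
  funext x; unfold pd; rw [fderiv_add_const]

lemma graphV_add_const {n : ℕ} (f : En n → ℝ) (k : ℝ) :
    graphV (fun y => f y + k) = graphV f := by
  funext x; unfold graphV gradNormSq; simp_rw [pd_add_const]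

lemma meanCurv_add_const {n : ℕ} (f : En n → ℝ) (k : ℝ) :
    meanCurv (fun y => f y + k) = meanCurv f := by
  funext x; unfold meanCurv; simp_rw [pd_add_const, graphV_add_const]

lemma Gop_add_const {n : ℕ} (alp f : En n → ℝ) (k : ℝ) :
    Gop alp (fun y => f y + k) = Gop alp f := by
  funext x; unfold Gop; simp_rw [meanCurv_add_const, graphV_add_const]

lemma meanCurv_const {n : ℕ} (k : ℝ) (x : En n) : meanCurv (fun _ => k) x = 0 := by
  simp [meanCurv, pd]

namespace IsAuxSolution
variable {n : ℕ} {S : AuxSetting n} {T : ℝ} {u : En n → ℝ → ℝ}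

lemma smoothAt (h : IsAuxSolution S T u) {x : En n} (hx : x ∈ S.Q) {t : ℝ} (ht : t ∈ Ioo 0 T) :
    ContDiffAt ℝ (⊤ : ℕ∞) (fun p : En n × ℝ => u p.1 p.2) (x, t) :=
  (h.1 (x, t) ⟨subset_closure hx, Ioo_subset_Icc_self ht⟩).contDiffAt
    (prod_mem_nhds (S.nhds_K hx) (Icc_mem_nhds ht.1 ht.2))

lemma slice (h : IsAuxSolution S T u) {t : ℝ} (ht : t ∈ Icc 0 T) :
    ContDiffOn ℝ (⊤ : ℕ∞) (fun y => u y t) (closure S.Q) := by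
  have : ContDiffOn ℝ (⊤ : ℕ∞) (fun y : En n => (y, t)) (closure S.Q) :=
    contDiffOn_id.prodMk contDiffOn_const
  exact h.1.comp this fun y hy => ⟨hy, ht⟩

lemma sliceAt (h : IsAuxSolution S T u) {t : ℝ} (ht : t ∈ Icc 0 T) {x : En n} (hx : x ∈ S.Q) :
    ContDiffAt ℝ (⊤ : ℕ∞) (fun y => u y t) x :=
  (h.slice ht x (subset_closure hx)).contDiffAt (S.nhds_K hx)

lemma timeDiff (h : IsAuxSolution S T u) {x : En n} (hx : x ∈ S.Q) {t : ℝ} (ht : t ∈ Ioo 0 T) :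
    DifferentiableAt ℝ (u x) t := by
  have h1 := (h.smoothAt hx ht).differentiableAt (by simp)
  have h2 : DifferentiableAt ℝ (fun s : ℝ => (x, s)) t := by fun_prop
  exact DifferentiableAt.comp (g := fun p : En n × ℝ => u p.1 p.2) t h1 h2

lemma pde (h : IsAuxSolution S T u) {x : En n} (hx : x ∈ S.Q) {t : ℝ} (ht : t ∈ Ioo 0 T) :
    deriv (u x) t = Gop S.alp (fun y => u y t) x - S.src x := h.2.2.1 x hx t ⟨ht.1, ht.2.le⟩

lemma src_nonneg {x : En n} (hx : x ∈ S.Q) : 0 ≤ S.src x := by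
  have h1 := S.hxi_range x (subset_closure hx)
  have h2 := S.hGc x (subset_closure hx)
  exact mul_nonneg h1.1 (by linarith)

lemma cont (h : IsAuxSolution S T u) {T' : ℝ} (hT' : T' < T) :
    ContinuousOn (fun p : En n × ℝ => u p.1 p.2) (closure S.Q ×ˢ Icc 0 T') :=
  h.1.continuousOn.mono (prod_mono subset_rfl (Icc_subset_Icc_right hT'.le))

lemma cont_u0 {T' : ℝ} : ContinuousOn (fun p : En n × ℝ => S.u0 p.1) (closure S.Q ×ˢ Icc 0 T') :=
  S.hu0_smooth.continuousOn.comp continuousOn_fst fun _ hp => hp.1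

lemma u0At {x : En n} (hx : x ∈ S.Q) : ContDiffAt ℝ (⊤ : ℕ∞) S.u0 x :=
  (S.hu0_smooth x (subset_closure hx)).contDiffAt (S.nhds_K hx)

lemma deriv_lin (a b t : ℝ) : HasDerivAt (fun t : ℝ => a + b * t) b t := by
  simpa using ((hasDerivAt_id t).const_mul b).const_add a

lemma two_le_top : (2 : WithTop ℕ∞) ≤ ((⊤ : ℕ∞) : WithTop ℕ∞) := by
  exact WithTop.coe_le_coe.mpr (le_top : (2 : ℕ∞) ≤ ⊤)

lemma three_le_top : (3 : WithTop ℕ∞) ≤ ((⊤ : ℕ∞) : WithTop ℕ∞) := by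
  exact WithTop.coe_le_coe.mpr (le_top : (3 : ℕ∞) ≤ ⊤)

lemma lower (h : IsAuxSolution S T u) {T' : ℝ} (hT' : T' < T) :
    ∀ x ∈ closure S.Q, ∀ t ∈ Icc 0 T', S.u0 x + S.c * t ≤ u x t := by
  have hio : ∀ {t : ℝ}, t ∈ Ioc 0 T' → t ∈ Ioo 0 T := fun ht => ⟨ht.1, ht.2.trans_lt hT'⟩
  refine comparison S.Q S.alp S.src S.isOpen_Q S.hbdd
    (fun x hx => (S.halp_pos x (subset_closure hx)).le) T' (fun x t => S.u0 x + S.c * t) u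
    (cont_u0.add (by fun_prop)) (h.cont hT') ?_ ?_ ?_ ?_ ?_ ?_ ?_ ?_ ?_
  · exact fun x hx t _ => ((u0At hx).of_le two_le_top).add contDiffAt_const
  · exact fun x hx t ht => (h.sliceAt (Ioo_subset_Icc_self (hio ht)) hx).of_le two_le_top
  · exact fun x hx t _ => (deriv_lin _ _ t).differentiableAt
  · exact fun x hx t ht => h.timeDiff hx (hio ht)
  · intro x hx t _
    rw [meanCurv_add_const]
    exact (S.hu0_H x (subset_closure hx)).le
  · intro x hx t _
    rw [Gop_add_const, (deriv_lin _ _ t).deriv]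
    have h1 := S.hxi_range x (subset_closure hx)
    have h2 := S.hGc x (subset_closure hx)
    simp only [AuxSetting.src]
    nlinarith [h1.1, h1.2]
  · exact fun x hx t ht => (h.pde hx (hio ht)).ge
  · intro x hx; rw [h.2.2.2.2 x hx]; simp
  · intro x hx t ht
    rw [h.2.2.2.1 x hx t ⟨ht.1, ht.2.trans hT'.le⟩, S.hu0_bdry x hx]; simp

lemma upper (h : IsAuxSolution S T u) {T' : ℝ} (hT' : T' < T) :
    ∀ x ∈ closure S.Q, ∀ t ∈ Icc 0 T', u x t ≤ S.c * t := by
  have hio : ∀ {t : ℝ}, t ∈ Ioc 0 T' → t ∈ Ioo 0 T := fun ht => ⟨ht.1, ht.2.trans_lt hT'⟩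
  have hlin : ∀ t, HasDerivAt (fun t : ℝ => S.c * t) S.c t := fun t => by
    simpa using (hasDerivAt_id t).const_mul S.c
  refine comparison S.Q S.alp S.src S.isOpen_Q S.hbdd
    (fun x hx => (S.halp_pos x (subset_closure hx)).le) T' u (fun x t => S.c * t)
    (h.cont hT') (by fun_prop) ?_ ?_ ?_ ?_ ?_ ?_ ?_ ?_ ?_
  · exact fun x hx t ht => (h.sliceAt (Ioo_subset_Icc_self (hio ht)) hx).of_le two_le_top
  · exact fun x hx t _ => contDiffAt_const
  · exact fun x hx t ht => h.timeDiff hx (hio ht)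
  · exact fun x hx t _ => (hlin t).differentiableAt
  · exact fun x hx t ht => (h.2.1 t (Ioo_subset_Icc_self (hio ht)) x (subset_closure hx)).le
  · exact fun x hx t ht => (h.pde hx (hio ht)).le
  · intro x hx t _
    rw [(hlin t).deriv]
    have := src_nonneg hx
    unfold Gop
    rw [meanCurv_const, Real.zero_rpow (S.halp_pos x (subset_closure hx)).ne', mul_zero]
    linarith [S.hc]
  · intro x hx
    rw [h.2.2.2.2 x hx]; simpa using S.hu0_nonpos x hx
  · intro x hx t ht
    rw [h.2.2.2.1 x hx t ⟨ht.1, ht.2.trans hT'.le⟩]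

lemma upper2 (h : IsAuxSolution S T u) {M : ℝ} (hM : ∀ x ∈ S.Q, Gop S.alp S.u0 x ≤ M)
    (hcM : S.c ≤ M) {T' : ℝ} (hT' : T' < T) :
    ∀ x ∈ closure S.Q, ∀ t ∈ Icc 0 T', u x t ≤ S.u0 x + M * t := by
  have hio : ∀ {t : ℝ}, t ∈ Ioc 0 T' → t ∈ Ioo 0 T := fun ht => ⟨ht.1, ht.2.trans_lt hT'⟩
  refine comparison S.Q S.alp S.src S.isOpen_Q S.hbdd
    (fun x hx => (S.halp_pos x (subset_closure hx)).le) T' u (fun x t => S.u0 x + M * t)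
    (h.cont hT') (cont_u0.add (by fun_prop)) ?_ ?_ ?_ ?_ ?_ ?_ ?_ ?_ ?_
  · exact fun x hx t ht => (h.sliceAt (Ioo_subset_Icc_self (hio ht)) hx).of_le two_le_top
  · exact fun x hx t _ => ((u0At hx).of_le two_le_top).add contDiffAt_const
  · exact fun x hx t ht => h.timeDiff hx (hio ht)
  · exact fun x hx t _ => (deriv_lin _ _ t).differentiableAt
  · exact fun x hx t ht => (h.2.1 t (Ioo_subset_Icc_self (hio ht)) x (subset_closure hx)).le
  · exact fun x hx t ht => (h.pde hx (hio ht)).le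
  · intro x hx t _
    rw [Gop_add_const, (deriv_lin _ _ t).deriv]
    have := src_nonneg hx
    linarith [hM x hx]
  · intro x hx; rw [h.2.2.2.2 x hx]; simp
  · intro x hx t ht
    rw [h.2.2.2.1 x hx t ⟨ht.1, ht.2.trans hT'.le⟩, S.hu0_bdry x hx]
    nlinarith [ht.1]

lemma incr (h : IsAuxSolution S T u) {M : ℝ} (hM : ∀ x ∈ S.Q, Gop S.alp S.u0 x ≤ M)
    (hcM : S.c ≤ M) {T' δ : ℝ} (h0 : 0 ≤ T') (hδ : 0 < δ) (hT' : T' + δ < T) :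
    ∀ x ∈ closure S.Q, ∀ t ∈ Icc 0 T', u x (t + δ) ≤ u x t + M * δ := by
  have hio : ∀ {t : ℝ}, t ∈ Ioc 0 T' → t ∈ Ioo 0 T :=
    fun ht => ⟨ht.1, by linarith [ht.2]⟩
  have hio2 : ∀ {t : ℝ}, t ∈ Ioc 0 T' → t + δ ∈ Ioo 0 T :=
    fun ht => ⟨by linarith [ht.1], by linarith [ht.2]⟩
  have hder : ∀ x ∈ S.Q, ∀ t ∈ Ioc 0 T', HasDerivAt (fun t => u x (t + δ))
      (deriv (u x) (t + δ)) t := by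
    intro x hx t ht
    exact (h.timeDiff hx (hio2 ht)).hasDerivAt.comp_add_const t δ
  refine comparison S.Q S.alp S.src S.isOpen_Q S.hbdd
    (fun x hx => (S.halp_pos x (subset_closure hx)).le) T' (fun x t => u x (t + δ))
    (fun x t => u x t + M * δ) ?_ ((h.cont (by linarith)).add continuousOn_const)
     ?_ ?_ ?_ ?_ ?_ ?_ ?_ ?_ ?_
  · have : ContinuousOn (fun p : En n × ℝ => (p.1, p.2 + δ)) (closure S.Q ×ˢ Icc 0 T') := by
      fun_prop
    exact (h.cont hT').comp this fun p hp => ⟨hp.1, by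
      constructor
      · linarith [hp.2.1]
      · linarith [hp.2.2]⟩
  · exact fun x hx t ht => (h.sliceAt (Ioo_subset_Icc_self (hio2 ht)) hx).of_le two_le_top
  · exact fun x hx t ht =>
      ((h.sliceAt (Ioo_subset_Icc_self (hio ht)) hx).of_le two_le_top).add contDiffAt_const
  · exact fun x hx t ht => (hder x hx t ht).differentiableAt
  · exact fun x hx t ht => (h.timeDiff hx (hio ht)).add_const _
  · exact fun x hx t ht => (h.2.1 _ (Ioo_subset_Icc_self (hio2 ht)) x (subset_closure hx)).le
  · intro x hx t ht
    rw [(hder x hx t ht).deriv]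
    exact (h.pde hx (hio2 ht)).le
  · intro x hx t ht
    rw [Gop_add_const, deriv_add_const]
    exact (h.pde hx (hio ht)).ge
  · intro x hx
    have := h.upper2 hM hcM (T' := δ) (by linarith) x hx δ ⟨hδ.le, le_rfl⟩
    simp only [zero_add]
    rw [h.2.2.2.2 x hx]; exact this
  · intro x hx t ht
    rw [h.2.2.2.1 x hx t ⟨ht.1, by linarith [ht.2]⟩,
      h.2.2.2.1 x hx (t + δ) ⟨by linarith [ht.1], by linarith [ht.2]⟩]
    nlinarith

lemma deriv_le (h : IsAuxSolution S T u) {M : ℝ} (hM : ∀ x ∈ S.Q, Gop S.alp S.u0 x ≤ M)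
    (hcM : S.c ≤ M) {x : En n} (hx : x ∈ S.Q) {t : ℝ} (ht : t ∈ Ioo 0 T) :
    deriv (u x) t ≤ M := by
  have hsl := (h.timeDiff hx ht).hasDerivAt.hasDerivWithinAt (s := Ioi t)
  rw [hasDerivWithinAt_iff_tendsto_slope' (by simp)] at hsl
  refine le_of_tendsto hsl ?_
  filter_upwards [Ioo_mem_nhdsGT ht.2] with r hr
  rw [slope_def_field]
  have := h.incr hM hcM (T' := t) (δ := r - t) ht.1.le (by linarith [hr.1]) (by linarith [hr.2])
    x (subset_closure hx) t ⟨ht.1.le, le_rfl⟩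
  rw [add_sub_cancel] at this
  rw [div_le_iff₀ (by linarith [hr.1])]
  linarith

end IsAuxSolution


lemma crit_lemma {n : ℕ} {f : En n → ℝ} {x e : En n} {k : ℝ} (hf : ContDiffAt ℝ 3 f x)
    (hm : IsLocalMax (fun y => dd f e y * Real.exp (f y - k)) x) :
    (∀ d, dd (dd f e) d x = - dd f e x * dd f d x) ∧
    (∀ d, dd (dd (dd f e) d) d x ≤ dd f e x * ((dd f d x) ^ 2 - dd (dd f d) d x)) := by
  have h2 : ContDiffAt ℝ 2 f x := hf.of_le (by norm_num)
  have hz2 : ContDiffAt ℝ 2 (dd f e) x := dd_contDiffAt hf (by norm_num) e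
  set φ : En n → ℝ := fun y => dd f e y * Real.exp (f y - k) with hφ
  have hφ2 : ContDiffAt ℝ 2 φ x := hz2.mul (Real.contDiff_exp.contDiffAt.comp x (h2.sub contDiffAt_const))
  have hd : ∀ d, ∀ y, ContDiffAt ℝ 2 f y → ContDiffAt ℝ 2 (dd f e) y →
      dd φ d y = (dd (dd f e) d y + dd f e y * dd f d y) * Real.exp (f y - k) := by
    intro d y h1 h2
    have a1 : HasDerivAt (fun r : ℝ => dd f e (y + r • d)) (dd (dd f e) d y) 0 :=
      hasDerivAt_line0 (h2.differentiableAt (by norm_num))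
    have a2 : HasDerivAt (fun r : ℝ => f (y + r • d)) (dd f d y) 0 :=
      hasDerivAt_line0 (h1.differentiableAt (by norm_num))
    have a3 := a1.mul (a2.sub_const k).exp
    have hdφ : DifferentiableAt ℝ φ y := by
      have b1 := h2.differentiableAt (by norm_num)
      have b2 := h1.differentiableAt (by norm_num)
      simp only [hφ]; fun_prop
    have a4 : HasDerivAt (fun r : ℝ => φ (y + r • d)) (dd φ d y) 0 := hasDerivAt_line0 hdφ
    rw [a4.unique a3]
    simp; ring
  have hE := Real.exp_pos (f x - k)
  have hcrit : ∀ d, dd (dd f e) d x + dd f e x * dd f d x = 0 := by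
    intro d
    have a1 := hd d x h2 hz2
    have a2 : dd φ d x = 0 := by unfold dd; rw [hm.fderiv_eq_zero]; rfl
    rw [a2] at a1
    rcases mul_eq_zero.mp a1.symm with h | h
    · exact h
    · exact absurd h hE.ne'
  refine ⟨fun d => by linarith [hcrit d], fun d => ?_⟩
  have hs := dd_dd_nonpos hφ2 hm d
  have hev : dd φ d =ᶠ[nhds x]
      fun y => (dd (dd f e) d y + dd f e y * dd f d y) * Real.exp (f y - k) := by
    filter_upwards [h2.eventually (by simp), hz2.eventually (by simp)] with y h1 h2
      using hd d y h1 h2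
  rw [dd_congr hev] at hs
  have d1 : DifferentiableAt ℝ (dd (dd f e) d) x :=
    (dd_contDiffAt (k := 1) hz2 (by norm_num) d).differentiableAt (by norm_num)
  have d2 : DifferentiableAt ℝ (dd f e) x := hz2.differentiableAt (by norm_num)
  have d3 : DifferentiableAt ℝ (dd f d) x :=
    (dd_contDiffAt (k := 1) h2 (by norm_num) d).differentiableAt (by norm_num)
  have d4 : DifferentiableAt ℝ f x := h2.differentiableAt (by norm_num)
  have b1 := ((hasDerivAt_line0 (d := d) d1).add ((hasDerivAt_line0 (d := d) d2).mul
    (hasDerivAt_line0 (d := d) d3))).mul ((hasDerivAt_line0 (d := d) d4).sub_const k).exp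
  have b2 : HasDerivAt (fun r : ℝ => (dd (dd f e) d (x + r • d)
      + dd f e (x + r • d) * dd f d (x + r • d)) * Real.exp (f (x + r • d) - k)) _ 0 :=
    hasDerivAt_line0 (f := fun y => (dd (dd f e) d y + dd f e y * dd f d y) * Real.exp (f y - k))
      (by fun_prop)
  rw [b2.unique b1] at hs
  have hc := hcrit d
  simp only [Pi.add_apply, Pi.mul_apply, zero_smul, add_zero] at hs
  rw [hc, zero_mul, add_zero] at hs
  have hs' := nonpos_of_mul_nonpos_left hs hE
  have hc' : dd (dd f e) d x = - (dd f e x * dd f d x) := by linarith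
  rw [hc'] at hs'
  linarith

lemma G_log_bound {v H al a M : ℝ} (hv1 : 1 ≤ v) (hH : 0 < H) (ha : 0 < a) (hal : a ≤ al)
    (hG : v * H ^ al ≤ 2 * M) :
    |v * H ^ al * Real.log H| ≤ (1 + 4 * M ^ 2 + 2 * M * Real.log v) / a := by
  have hv : 0 < v := by linarith
  have hal0 : 0 < al := by linarith
  set G := v * H ^ al with hGd
  have hGpos : 0 < G := by positivity
  have hlogG : Real.log G = Real.log v + al * Real.log H := by
    rw [hGd, Real.log_mul hv.ne' (by positivity), Real.log_rpow hH]
  have hlogH : Real.log H = (Real.log G - Real.log v) / al := by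
    rw [hlogG]; field_simp; ring
  have hlv : 0 ≤ Real.log v := Real.log_nonneg hv1
  have h1 : G * Real.log G ≤ 4 * M ^ 2 := by
    have := Real.log_le_sub_one_of_pos hGpos
    nlinarith
  have h2 : -1 ≤ G * Real.log G := by
    have := Real.one_sub_inv_le_log_of_pos hGpos
    have h3 : G * (1 - G⁻¹) = G - 1 := by field_simp
    nlinarith
  have h3 : |G * (Real.log G - Real.log v)| ≤ 1 + 4 * M ^ 2 + 2 * M * Real.log v := by
    have h5 : G * Real.log v ≤ 2 * M * Real.log v := mul_le_mul_of_nonneg_right hG hlv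
    have h6 : 0 ≤ G * Real.log v := by positivity
    rw [abs_le]; constructor <;> nlinarith [sq_nonneg M]
  rw [hlogH, ← mul_div_assoc, abs_div, abs_of_pos hal0]
  have h4 : 0 ≤ 1 + 4 * M ^ 2 + 2 * M * Real.log v := (abs_nonneg _).trans h3
  exact div_le_div₀ h4 h3 ha hal

/-- The a priori bound at an interior maximum. -/
def Rbd (c M a : ℝ) : ℝ :=
  (2 / c) * (3 * M + M * (1 + 4 * M ^ 2) / a - (2 * M ^ 2 / a) * Real.log (c * a / (8 * M ^ 2)))

lemma final_scalar {z v H al a M c h' al' s' zt ut : ℝ} (hc : 0 < c) (hM : 0 < M) (ha : 0 < a)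
    (hz : 1 ≤ z) (hv : 0 < v) (hv2 : v ^ 2 = 1 + z ^ 2) (hH : 0 < H) (hal : a ≤ al)
    (hG : v * H ^ al ≤ 2 * M) (hh' : h' ≤ 0) (hal' : |al'| ≤ M) (hs' : |s'| ≤ M)
    (hzt : zt = -(z * z ^ 2) / v * H ^ al
      + v * (h' * al * H ^ (al - 1) + al' * H ^ al * Real.log H) - s')
    (htime : 0 ≤ zt + z * (ut - c)) (hut : ut ≤ v * H ^ al) :
    z ≤ Rbd c M a := by
  have hv1 : 1 ≤ v := by nlinarith
  have hvz : v ≤ 2 * z := by nlinarith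
  have hzv : z ≤ v ^ 2 := by nlinarith
  have hb := G_log_bound hv1 hH ha hal hG
  set G := v * H ^ al with hGd
  have hGpos : 0 < G := by positivity
  set ε := c * a / (8 * M ^ 2) with hε
  have hεpos : 0 < ε := by positivity
  have hlog : Real.log v ≤ 2 * ε * z - Real.log ε := by
    have h1 := Real.log_le_sub_one_of_pos (mul_pos hεpos hv)
    rw [Real.log_mul hεpos.ne' hv.ne'] at h1
    nlinarith
  have e1 : -(z * z ^ 2) / v * H ^ al + z * G = z / v ^ 2 * G := by
    have : z ^ 2 = v ^ 2 - 1 := by linarith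
    rw [this, hGd]; field_simp; ring
  have e2 : z / v ^ 2 * G ≤ 2 * M := by
    have : z / v ^ 2 ≤ 1 := by rw [div_le_one (by positivity)]; exact hzv
    nlinarith
  have e3 : v * (h' * al * H ^ (al - 1) + al' * H ^ al * Real.log H)
      ≤ M * ((1 + 4 * M ^ 2 + 2 * M * Real.log v) / a) := by
    have h1 : v * (h' * al * H ^ (al - 1)) ≤ 0 := by
      apply mul_nonpos_of_nonneg_of_nonpos hv.le
      apply mul_nonpos_of_nonpos_of_nonneg _ (by positivity)
      apply mul_nonpos_of_nonpos_of_nonneg hh' (by linarith)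
    have h2 : al' * (G * Real.log H) ≤ M * ((1 + 4 * M ^ 2 + 2 * M * Real.log v) / a) := by
      refine (le_abs_self _).trans ?_
      rw [abs_mul]
      exact mul_le_mul hal' hb (abs_nonneg _) hM.le
    have h3 : v * (h' * al * H ^ (al - 1) + al' * H ^ al * Real.log H)
      = v * (h' * al * H ^ (al - 1)) + al' * (G * Real.log H) := by rw [hGd]; ring
    linarith
  have e4 : M * ((1 + 4 * M ^ 2 + 2 * M * Real.log v) / a)
      ≤ M * (1 + 4 * M ^ 2) / a + (2 * M ^ 2 / a) * (2 * ε * z - Real.log ε) := by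
    have h1 : M * ((1 + 4 * M ^ 2 + 2 * M * Real.log v) / a)
      = M * (1 + 4 * M ^ 2) / a + (2 * M ^ 2 / a) * Real.log v := by field_simp
    rw [h1]
    have : 0 ≤ 2 * M ^ 2 / a := by positivity
    nlinarith
  have e5 : (2 * M ^ 2 / a) * (2 * ε * z) = c * z / 2 := by
    rw [hε]; field_simp; ring
  have e6 : -s' ≤ M := by linarith [neg_abs_le s']
  have e7 : z * ut ≤ z * G := mul_le_mul_of_nonneg_left hut (by linarith)
  have e8 : c * z / 2 ≤ 3 * M + M * (1 + 4 * M ^ 2) / a - (2 * M ^ 2 / a) * Real.log ε := by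
    rw [mul_sub, e5] at e4
    rw [mul_sub] at htime
    linarith
  unfold Rbd
  rw [← hε]
  have e9 : z = (2 / c) * (c * z / 2) := by field_simp
  rw [e9]
  exact mul_le_mul_of_nonneg_left e8 (by positivity)

namespace IsAuxSolution
variable {n : ℕ} {S : AuxSetting n} {T : ℝ} {u : En n → ℝ → ℝ}

lemma ddF_space {x e : En n} {t : ℝ}
    (hd : DifferentiableAt ℝ (fun p : En n × ℝ => u p.1 p.2) (x, t)) :
    dd (fun p : En n × ℝ => u p.1 p.2) (e, 0) (x, t) = dd (fun y => u y t) e x := by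
  have h1 : HasFDerivAt (fun y : En n => (y, t)) (ContinuousLinearMap.inl ℝ (En n) ℝ) x := 
    hasFDerivAt_prodMk_left x t
  have h2 := (HasFDerivAt.comp (g := fun p : En n × ℝ => u p.1 p.2) x hd.hasFDerivAt h1).fderiv
  unfold dd
  have h3 : fderiv ℝ (fun y => u y t) x = _ := h2
  rw [h3]; simp

lemma ddF_time {x : En n} {t : ℝ}
    (hd : DifferentiableAt ℝ (fun p : En n × ℝ => u p.1 p.2) (x, t)) :
    dd (fun p : En n × ℝ => u p.1 p.2) (0, 1) (x, t) = deriv (u x) t := by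
  have h1 : HasDerivAt (fun s : ℝ => (x, s)) ((0 : En n), (1:ℝ)) t :=
    (hasDerivAt_const t x).prodMk (hasDerivAt_id t)
  have h2 := (hd.hasFDerivAt.comp_hasDerivAt t h1).deriv
  exact h2.symm

lemma interior_crit (h : IsAuxSolution S T u) {M a : ℝ} (ha : 0 < a) (hM0 : 0 < M) (hcM : S.c ≤ M)
    (hM : ∀ x ∈ S.Q, Gop S.alp S.u0 x ≤ M) (hal : ∀ x ∈ S.Q, a ≤ S.alp x)
    (hal' : ∀ x ∈ S.Q, ‖fderiv ℝ S.alp x‖ ≤ M)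
    (hsrc : ∀ x ∈ S.Q, DifferentiableAt ℝ S.src x ∧ ‖fderiv ℝ S.src x‖ ≤ M)
    {x0 : En n} {t0 : ℝ} (hx0 : x0 ∈ S.Q) (ht0 : t0 ∈ Ioo 0 T)
    (hz1 : 1 ≤ ‖fderiv ℝ (fun y => u y t0) x0‖)
    (hmax : ∀ x ∈ S.Q, ∀ t ∈ Ioc 0 t0, ‖fderiv ℝ (fun y => u y t) x‖ * Real.exp (u x t - S.c * t)
      ≤ ‖fderiv ℝ (fun y => u y t0) x0‖ * Real.exp (u x0 t0 - S.c * t0)) :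
    ‖fderiv ℝ (fun y => u y t0) x0‖ ≤ Rbd S.c M a := by
  set f : En n → ℝ := fun y => u y t0 with hfdef
  set z : ℝ := ‖fderiv ℝ f x0‖ with hzdef
  have hz0 : 0 < z := by linarith
  have hfS : ContDiffAt ℝ (⊤ : ℕ∞) f x0 := h.sliceAt (Ioo_subset_Icc_self ht0) hx0
  have hf3 : ContDiffAt ℝ 3 f x0 := hfS.of_le three_le_top
  have hf2 : ContDiffAt ℝ 2 f x0 := hfS.of_le two_le_top
  -- the gradient direction
  obtain ⟨g, hg⟩ := (InnerProductSpace.toDual ℝ (En n)).surjective (fderiv ℝ f x0)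
  have hgn : ‖g‖ = z := by rw [hzdef, ← hg]; simp
  set e : En n := z⁻¹ • g with hedef
  have hen : ‖e‖ = 1 := by
    rw [hedef, norm_smul, hgn, Real.norm_of_nonneg (by positivity)]; field_simp
  have hpe : ∀ i, pd f i x0 = z * e i := by
    intro i
    unfold pd
    rw [← hg]
    simp only [hedef, InnerProductSpace.toDual_apply_apply, EuclideanSpace.inner_single_right,
      PiLp.smul_apply, smul_eq_mul]
    field_simp
    simp
  have he1 : ∑ i, e i ^ 2 = 1 := by
    have := EuclideanSpace.norm_sq_eq e
    rw [hen] at this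
    simpa using this.symm
  have hze : dd f e x0 = z := by
    rw [dd_expand]
    simp_rw [hpe]
    have : ∀ i, e i * (z * e i) = z * e i ^ 2 := fun i => by ring
    simp_rw [this]
    rw [← Finset.mul_sum, he1, mul_one]
  have hle : ∀ (A : En n →L[ℝ] ℝ), |A e| ≤ ‖A‖ := fun A => by
    have := A.le_opNorm e
    rwa [hen, mul_one] at this
  have hle2 : ∀ x ∈ S.Q, ∀ t ∈ Ioc 0 t0, dd (fun y => u y t) e x * Real.exp (u x t - S.c * t)
      ≤ z * Real.exp (u x0 t0 - S.c * t0) := by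
    intro x hx t ht
    refine le_trans ?_ (hmax x hx t ht)
    exact mul_le_mul_of_nonneg_right ((le_abs_self _).trans (hle _)) (Real.exp_pos _).le
  -- spatial criticality
  have hloc : IsLocalMax (fun y => dd f e y * Real.exp (f y - S.c * t0)) x0 := by
    filter_upwards [S.isOpen_Q.mem_nhds hx0] with y hy
    rw [hze]
    exact hle2 y hy t0 ⟨ht0.1, le_rfl⟩
  obtain ⟨hcrit, hsec⟩ := crit_lemma hf3 hloc
  rw [hze] at hcrit hsec
  have hH : 0 < meanCurv f x0 := h.2.1 t0 (Ioo_subset_Icc_self ht0) x0 (subset_closure hx0)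
  have hHd := meanCurv_dd_nonpos hf3 hz1 hpe he1 hcrit hsec hH
  -- time derivative
  set F : En n × ℝ → ℝ := fun p => u p.1 p.2 with hF
  have hFS : ContDiffAt ℝ (⊤ : ℕ∞) F (x0, t0) := h.smoothAt hx0 ht0
  have hF2 : ContDiffAt ℝ 2 F (x0, t0) := hFS.of_le two_le_top
  have hFev : ∀ᶠ p in nhds (x0, t0), DifferentiableAt ℝ F p := by
    filter_upwards [hF2.eventually (by simp)] with p hp using hp.differentiableAt (by norm_num)
  set zt : ℝ := dd (dd F (e, 0)) (0, 1) (x0, t0) with hzt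
  have hz_t : HasDerivAt (fun t => dd (fun y => u y t) e x0) zt t0 := by
    have hd : DifferentiableAt ℝ (dd F (e, 0)) (x0, t0) :=
      (dd_contDiffAt (k := 1) hF2 (by norm_num) _).differentiableAt (by norm_num)
    have h1 : HasDerivAt (fun s : ℝ => (x0, s)) ((0 : En n), (1:ℝ)) t0 :=
      (hasDerivAt_const t0 x0).prodMk (hasDerivAt_id t0)
    have h2 := hd.hasFDerivAt.comp_hasDerivAt t0 h1
    refine HasDerivAt.congr_of_eventuallyEq h2 ?_
    have hc : Filter.Tendsto (fun s : ℝ => (x0, s)) (nhds t0) (nhds (x0, t0)) := h1.continuousAt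
    filter_upwards [hc.eventually hFev] with t ht
    exact (ddF_space ht).symm
  have hut := (h.timeDiff hx0 ht0).hasDerivAt
  have htime : 0 ≤ zt + z * (deriv (u x0) t0 - S.c) := by
    have hlin : HasDerivAt (fun t : ℝ => S.c * t) S.c t0 := by
      simpa using (hasDerivAt_id t0).const_mul S.c
    have hder := hz_t.mul (hut.sub hlin).exp
    have hsl := hder.hasDerivWithinAt (s := Iio t0)
    rw [hasDerivWithinAt_iff_tendsto_slope' (by simp)] at hsl
    have hnn := ge_of_tendsto (b := 0) hsl (by
      filter_upwards [Ioo_mem_nhdsLT ht0.1] with t htt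
      rw [slope_def_field]
      apply div_nonneg_of_nonpos
      · have := hle2 x0 hx0 t ⟨htt.1, htt.2.le⟩
        rw [← hze] at this
        simp only [Pi.mul_apply, Pi.sub_apply]
        linarith
      · linarith [htt.2])
    have hE := Real.exp_pos (u x0 t0 - S.c * t0)
    have e0 : dd (fun y => u y t0) e x0 = z := hze
    simp only [Pi.sub_apply, e0] at hnn
    have : 0 ≤ (zt + z * (deriv (u x0) t0 - S.c)) * Real.exp (u x0 t0 - S.c * t0) := by
      linarith
    exact nonneg_of_mul_nonneg_left this hE
  -- differentiate the equation
  have hzt2 : zt = dd (dd F (0, 1)) (e, 0) (x0, t0) := dd_symm hF2 _ _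
  have hald : DifferentiableAt ℝ S.alp x0 :=
    ((S.halp_smooth x0 (subset_closure hx0)).contDiffAt (S.nhds_K hx0)).differentiableAt (by simp)
  set v := graphV f x0 with hvdef
  have hv := graphV_pos f x0
  have hgn2 : gradNormSq f x0 = z ^ 2 := gradNormSq_eq f x0
  have hv2 : v ^ 2 = 1 + z ^ 2 := by rw [hvdef, graphV_sq, hgn2]
  have hlv : HasDerivAt (fun r : ℝ => graphV f (x0 + r • e)) (-(z * z ^ 2) / v) 0 := by
    refine (graphV_line hf2 e).congr_deriv ?_
    congr 1
    have hP' : ∀ i, dd (pd f i) e x0 = - z * pd f i x0 := by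
      intro i
      have : dd (pd f i) e x0 = dd (dd f e) (EuclideanSpace.single i 1) x0 := dd_symm hf2 _ _
      rw [this, hcrit]; rfl
    simp_rw [hP']
    rw [← hgn2]
    unfold gradNormSq
    rw [Finset.mul_sum, ← Finset.sum_neg_distrib]
    exact Finset.sum_congr rfl fun i _ => by ring
  have hlH : HasDerivAt (fun r : ℝ => meanCurv f (x0 + r • e)) (dd (meanCurv f) e x0) 0 :=
    hasDerivAt_line0 (meanCurv_differentiableAt hf3)
  have hla : HasDerivAt (fun r : ℝ => S.alp (x0 + r • e)) (dd S.alp e x0) 0 :=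
    hasDerivAt_line0 hald
  have hls : HasDerivAt (fun r : ℝ => S.src (x0 + r • e)) (dd S.src e x0) 0 :=
    hasDerivAt_line0 (hsrc x0 hx0).1
  have hlG := (hlv.mul (hlH.rpow hla (by simpa using hH))).sub hls
  have hlF : HasDerivAt (fun r : ℝ => dd F (0, 1) ((x0, t0) + r • ((e, 0) : En n × ℝ))) zt 0 := by
    rw [hzt2]
    exact hasDerivAt_line0 ((dd_contDiffAt (k := 1) hF2 (by norm_num) _).differentiableAt
      (by norm_num))
  have hev : (fun r : ℝ => dd F (0, 1) ((x0, t0) + r • ((e, 0) : En n × ℝ))) =ᶠ[nhds 0]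
      fun r => graphV f (x0 + r • e) * meanCurv f (x0 + r • e) ^ S.alp (x0 + r • e)
        - S.src (x0 + r • e) := by
    filter_upwards [(line_tendsto (x0, t0) ((e, 0) : En n × ℝ)).eventually hFev,
      (line_tendsto x0 e).eventually (S.isOpen_Q.mem_nhds hx0)] with r hr hrQ
    have e1 : (x0, t0) + r • ((e, 0) : En n × ℝ) = (x0 + r • e, t0) := by simp
    rw [e1] at hr ⊢
    rw [ddF_time hr, h.pde hrQ ht0]
    rfl
  have hzt3 := (hlF.congr_of_eventuallyEq hev.symm).unique hlG
  simp only [zero_smul, add_zero] at hzt3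
  have hpde := h.pde hx0 ht0
  have hsn := src_nonneg hx0
  have hutM := h.deriv_le hM hcM hx0 ht0
  have hGd : Gop S.alp (fun y => u y t0) x0 = v * meanCurv f x0 ^ S.alp x0 := rfl
  have hsM : S.src x0 ≤ M := by
    have h1 := S.hxi_range x0 (subset_closure hx0)
    have h2 := S.hGc x0 (subset_closure hx0)
    have h3 := hM x0 hx0
    simp only [AuxSetting.src]
    nlinarith [h1.1, h1.2, S.hc]
  rw [hGd] at hpde
  refine final_scalar (al := S.alp x0) (h' := dd (meanCurv f) e x0) (al' := dd S.alp e x0)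
    (s' := dd S.src e x0) (zt := zt) (ut := deriv (u x0) t0) S.hc hM0 ha hz1 hv hv2 hH (hal x0 hx0)
    (by linarith) hHd ((hle _).trans (hal' x0 hx0)) ((hle _).trans (hsrc x0 hx0).2) ?_ htime
    (by linarith)
  rw [hzt3]

end IsAuxSolution


namespace IsAuxSolution
variable {n : ℕ} {S : AuxSetting n} {T : ℝ} {u : En n → ℝ → ℝ}

/-- The spatial derivative, extended up to the boundary. -/
def sg (S : AuxSetting n) (T : ℝ) (u : En n → ℝ → ℝ) (p : En n × ℝ) : En n →L[ℝ] ℝ :=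
  (fderivWithin ℝ (fun p : En n × ℝ => u p.1 p.2) (closure S.Q ×ˢ Icc 0 T) p).comp
    (ContinuousLinearMap.inl ℝ (En n) ℝ)

lemma sg_cont (h : IsAuxSolution S T u) (hT : 0 < T) :
    ContinuousOn (sg S T u) (closure S.Q ×ˢ Icc 0 T) := by
  have h1 := h.1.continuousOn_fderivWithin (S.uniqueDiff.prod (uniqueDiffOn_Icc hT)) (by simp)
  exact h1.clm_comp continuousOn_const

lemma sg_has (h : IsAuxSolution S T u) {x : En n} (hx : x ∈ closure S.Q)
    {t : ℝ} (ht : t ∈ Icc 0 T) :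
    HasFDerivWithinAt (fun y => u y t) (sg S T u (x, t)) (closure S.Q) x := by
  have h1 : HasFDerivWithinAt (fun p : En n × ℝ => u p.1 p.2) _ (closure S.Q ×ˢ Icc 0 T) (x, t) :=
    ((h.1.differentiableOn (by simp)) (x, t) ⟨hx, ht⟩).hasFDerivWithinAt
  have h2 : HasFDerivWithinAt (fun y : En n => (y, t)) (ContinuousLinearMap.inl ℝ (En n) ℝ)
      (closure S.Q) x := (hasFDerivAt_prodMk_left x t).hasFDerivWithinAt
  have h3 : MapsTo (fun y : En n => (y, t)) (closure S.Q) (closure S.Q ×ˢ Icc 0 T) :=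
    fun y hy => ⟨hy, ht⟩
  exact HasFDerivWithinAt.comp x h1 h2 h3

lemma sg_eq (h : IsAuxSolution S T u) {x : En n} (hx : x ∈ S.Q)
    {t : ℝ} (ht : t ∈ Icc 0 T) : fderiv ℝ (fun y => u y t) x = sg S T u (x, t) :=
  ((h.sg_has (subset_closure hx) ht).hasFDerivAt (S.nhds_K hx)).fderiv

lemma fderiv_le_sg (h : IsAuxSolution S T u) {x : En n} (hx : x ∈ closure S.Q)
    {t : ℝ} (ht : t ∈ Icc 0 T) : ‖fderiv ℝ (fun y => u y t) x‖ ≤ ‖sg S T u (x, t)‖ := by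
  by_cases hd : DifferentiableAt ℝ (fun y => u y t) x
  · rw [(S.uniqueDiff x hx).eq hd.hasFDerivAt.hasFDerivWithinAt (h.sg_has hx ht)]
  · rw [fderiv_zero_of_not_differentiableAt hd]; simp

lemma sg_bound (h : IsAuxSolution S T u) (hT : 0 < T) {M a : ℝ} (ha : 0 < a) (hM0 : 0 < M)
    (hcM : S.c ≤ M)
    (hM : ∀ x ∈ S.Q, Gop S.alp S.u0 x ≤ M) (hal : ∀ x ∈ S.Q, a ≤ S.alp x)
    (hal' : ∀ x ∈ S.Q, ‖fderiv ℝ S.alp x‖ ≤ M)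
    (hsrc : ∀ x ∈ S.Q, DifferentiableAt ℝ S.src x ∧ ‖fderiv ℝ S.src x‖ ≤ M)
    (hu0 : ∀ x ∈ closure S.Q, |S.u0 x| ≤ M ∧ ‖fderivWithin ℝ S.u0 (closure S.Q) x‖ ≤ M)
    {T' : ℝ} (hT' : T' < T) {x : En n} (hx : x ∈ closure S.Q) {t : ℝ} (ht : t ∈ Icc 0 T') :
    ‖sg S T u (x, t)‖ ≤ max M (max 1 (Rbd S.c M a)) * Real.exp M := by
  have hsub : closure S.Q ×ˢ Icc 0 T' ⊆ closure S.Q ×ˢ Icc 0 T :=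
    prod_mono le_rfl (Icc_subset_Icc le_rfl hT'.le)
  have hcont : ContinuousOn
      (fun p : En n × ℝ => ‖sg S T u p‖ * Real.exp (u p.1 p.2 - S.c * p.2))
      (closure S.Q ×ˢ Icc 0 T') := by
    have h1 := (h.sg_cont hT).mono hsub
    have h2 := h.1.continuousOn.mono hsub
    exact h1.norm.mul (Real.continuous_exp.comp_continuousOn
      (h2.sub (continuousOn_const.mul continuousOn_snd)))
  obtain ⟨⟨x0, t0⟩, ⟨hx0, ht0⟩, hmax⟩ :=
    (S.isCompact_K.prod isCompact_Icc).exists_isMaxOn ⟨(x, t), hx, ht⟩ hcont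
  have ht0T : t0 ∈ Icc 0 T := ⟨ht0.1, ht0.2.trans hT'.le⟩
  simp only at hx0 ht0
  set B := max M (max 1 (Rbd S.c M a)) with hB
  have hu0d : HasFDerivWithinAt S.u0 (fderivWithin ℝ S.u0 (closure S.Q) x0) (closure S.Q) x0 :=
    (S.hu0_smooth.differentiableOn (by simp) x0 hx0).hasFDerivWithinAt
  have hbd : ‖sg S T u (x0, t0)‖ ≤ B := by
    rcases eq_or_lt_of_le ht0.1 with h0 | h0
    · have h1 : HasFDerivWithinAt S.u0 (sg S T u (x0, t0)) (closure S.Q) x0 := by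
        refine (h.sg_has hx0 ht0T).congr (fun y hy => ?_) ?_
        · rw [← h0]; exact (h.2.2.2.2 y hy).symm
        · rw [← h0]; exact (h.2.2.2.2 x0 hx0).symm
      rw [(S.uniqueDiff x0 hx0).eq h1 hu0d]
      exact (hu0 x0 hx0).2.trans (le_max_left _ _)
    · by_cases hQ : x0 ∈ S.Q
      · by_cases hz : ‖sg S T u (x0, t0)‖ ≤ 1
        · exact hz.trans ((le_max_left _ _).trans (le_max_right _ _))
        · have hres := h.interior_crit ha hM0 hcM hM hal hal' hsrc hQ
            (t0 := t0) ⟨h0, ht0.2.trans_lt hT'⟩ (by rw [h.sg_eq hQ ht0T]; exact (not_le.1 hz).le)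
            (by
              intro y hy s hs
              have hs' : s ∈ Icc 0 T' := ⟨hs.1.le, hs.2.trans ht0.2⟩
              rw [h.sg_eq hQ ht0T, h.sg_eq hy ⟨hs'.1, hs'.2.trans hT'.le⟩]
              exact hmax (show (y, s) ∈ closure S.Q ×ˢ Icc 0 T' from ⟨subset_closure hy, hs'⟩))
          rw [h.sg_eq hQ ht0T] at hres
          exact hres.trans ((le_max_right _ _).trans (le_max_right _ _))
      · have hf := S.mem_frontier hx0 hQ
        have := S.lateral hf (h.sg_has hx0 ht0T) hu0d
          (fun y hy => h.lower hT' y hy t0 ht0) (fun y hy => h.upper hT' y hy t0 ht0)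
          (h.2.2.2.1 x0 hf t0 ht0T) (S.hu0_bdry x0 hf)
        exact (this.trans (hu0 x0 hx0).2).trans (le_max_left _ _)
  have hB0 : 0 ≤ B := (norm_nonneg _).trans hbd
  have h1 : ‖sg S T u (x, t)‖ * Real.exp (u x t - S.c * t) ≤
      ‖sg S T u (x0, t0)‖ * Real.exp (u x0 t0 - S.c * t0) :=
    hmax (show (x, t) ∈ closure S.Q ×ˢ Icc 0 T' from ⟨hx, ht⟩)
  have h2 : Real.exp (u x0 t0 - S.c * t0) ≤ 1 := by
    rw [Real.exp_le_one_iff]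
    linarith [h.upper hT' x0 hx0 t0 ht0]
  have h3 : ‖sg S T u (x0, t0)‖ * Real.exp (u x0 t0 - S.c * t0) ≤ B * 1 :=
    mul_le_mul hbd h2 (Real.exp_pos _).le hB0
  have h4 : Real.exp (-M) ≤ Real.exp (u x t - S.c * t) := by
    rw [Real.exp_le_exp]
    linarith [h.lower hT' x hx t ht, (abs_le.1 (hu0 x hx).1).1]
  have h5 : ‖sg S T u (x, t)‖ * Real.exp (-M) ≤ B :=
    (mul_le_mul_of_nonneg_left h4 (norm_nonneg _)).trans (by linarith)
  calc ‖sg S T u (x, t)‖ = ‖sg S T u (x, t)‖ * Real.exp (-M) * Real.exp M := by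
        rw [mul_assoc, ← Real.exp_add]; simp
    _ ≤ B * Real.exp M := mul_le_mul_of_nonneg_right h5 (Real.exp_pos _).le

lemma sg_bound_all (h : IsAuxSolution S T u) (hT : 0 < T) {C : ℝ}
    (hC : ∀ T' < T, ∀ x ∈ closure S.Q, ∀ t ∈ Icc 0 T', ‖sg S T u (x, t)‖ ≤ C)
    {x : En n} (hx : x ∈ closure S.Q) {t : ℝ} (ht : t ∈ Icc 0 T) :
    ‖sg S T u (x, t)‖ ≤ C := by
  have hc : ContinuousOn (fun s : ℝ => ‖sg S T u (x, s)‖) (Icc 0 T) :=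
    ((h.sg_cont hT).comp (by fun_prop : ContinuousOn (fun s : ℝ => (x, s)) (Icc 0 T))
      (fun s hs => ⟨hx, hs⟩)).norm
  have hcl : closure (Ico 0 T) = Icc 0 T := closure_Ico hT.ne
  rw [← hcl] at hc ht
  have himg := hc.image_closure
  have : ‖sg S T u (x, t)‖ ∈ closure ((fun s : ℝ => ‖sg S T u (x, s)‖) '' Ico 0 T) :=
    himg ⟨t, ht, rfl⟩
  have hsub : closure ((fun s : ℝ => ‖sg S T u (x, s)‖) '' Ico 0 T) ⊆ Iic C := by
    refine closure_minimal ?_ isClosed_Iic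
    rintro _ ⟨s, hs, rfl⟩
    exact hC s hs.2 x hx s ⟨hs.1, le_rfl⟩
  exact hsub this

end IsAuxSolution


/-- Interior gradient bound `|∇u(x,t)| ≤ C·(1+t)` with `C` depending only
on the data of the auxiliary problem (and not on `T`). -/
theorem aux_problem_interior_gradient_bound (n : ℕ) (S : AuxSetting n) :
    ∃ C : ℝ, 0 < C ∧ ∀ T : ℝ, 0 < T → ∀ u : En n → ℝ → ℝ, IsAuxSolution S T u →
      ∀ x ∈ closure S.Q, ∀ t ∈ Set.Icc (0:ℝ) T,
        Real.sqrt (gradNormSq (fun y => u y t) x) ≤ C * (1 + t) := by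
  obtain ⟨M, a, ha, hM0, hcM, hM, hal, hal', hsrc, hu0⟩ := S.constants
  have hB : 0 < max M (max 1 (Rbd S.c M a)) * Real.exp M :=
    mul_pos (hM0.trans_le (le_max_left _ _)) (Real.exp_pos _)
  refine ⟨_, hB, ?_⟩
  intro T hT u h x hx t ht
  rw [gradNormSq_eq, Real.sqrt_sq (norm_nonneg _)]
  have h1 := h.sg_bound_all hT (fun T' hT' x hx t ht =>
    h.sg_bound hT ha hM0 hcM hM hal hal' hsrc hu0 hT' hx ht) hx ht
  have h2 := (h.fderiv_le_sg hx ht).trans h1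
  nlinarith [mul_nonneg hB.le ht.1]
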